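/- For each integer g ≥ 2 there exist a set A ⊆ ℕ, constants C > 0, c > 0 and a threshold N₀ ∈ ℕ such that: (i) A is a B₂[g] sequence; (ii) every integer n ≥ N₀ can be written as n = a₁ + a₂ + a₃ with a₁, a₂, a₃ ∈ A and a₃ ≤ C · n^{1/g} (log n)^{2 + 1/g}; and (iii) |A ∩ [1, x]| ≥ c · x^{g/(2g+1)} for every real x ≥ N₀. -/

import Mathlib

noncomputable section

/-- Number of representations of `m` as `b₁ + b₂` with `b₁ ≤ b₂`, `b₁, b₂ ∈ A`. -/
def rA (A : Set ℕ) (m : ℕ) : ℕ :=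
  Set.ncard {p : ℕ × ℕ | p.1 ∈ A ∧ p.2 ∈ A ∧ p.1 ≤ p.2 ∧ p.1 + p.2 = m}

/-- `A` is a `B₂[g]` sequence. -/
def IsB2g (A : Set ℕ) (g : ℕ) : Prop := ∀ m : ℕ, rA A m ≤ g

/-- `|A ∩ [1, x]|`. -/
def countTo (A : Set ℕ) (x : ℝ) : ℕ :=
  Set.ncard {a : ℕ | a ∈ A ∧ 1 ≤ a ∧ (a : ℝ) ≤ x}

/-! ### Random subsets of a finite set -/

/-- Expectation of `f X` when `X` contains each element of `Ω` independently with
probability `p`. -/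
def expect (p : ℝ) (Ω : Finset ℕ) (f : Finset ℕ → ℝ) : ℝ :=
  ∑ X ∈ Ω.powerset, p ^ X.card * (1 - p) ^ (Ω.card - X.card) * f X

open Classical in
/-- Indicator of a property of finite sets. -/
def ind (E : Finset ℕ → Prop) (X : Finset ℕ) : ℝ := if E X then 1 else 0

lemma ind_nonneg (E : Finset ℕ → Prop) (X : Finset ℕ) : 0 ≤ ind E X := by
  unfold ind; split_ifs <;> norm_num

lemma ind_of {E : Finset ℕ → Prop} {X : Finset ℕ} (h : E X) : ind E X = 1 := by
  simp [ind, h]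

lemma ind_of_not {E : Finset ℕ → Prop} {X : Finset ℕ} (h : ¬E X) : ind E X = 0 := by
  simp [ind, h]

lemma ind_congr {E E' : Finset ℕ → Prop} {X Y : Finset ℕ} (h : E X ↔ E' Y) :
    ind E X = ind E' Y := by
  by_cases h' : E X
  · rw [ind_of h', ind_of (h.1 h')]
  · rw [ind_of_not h', ind_of_not (mt h.2 h')]

lemma expect_mono {p : ℝ} (hp0 : 0 ≤ p) (hp1 : p ≤ 1) {Ω : Finset ℕ} {f h : Finset ℕ → ℝ}
    (hfh : ∀ X ⊆ Ω, f X ≤ h X) : expect p Ω f ≤ expect p Ω h := by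
  refine Finset.sum_le_sum fun X hX => ?_
  have : 0 ≤ 1 - p := by linarith
  exact mul_le_mul_of_nonneg_left (hfh X (Finset.mem_powerset.1 hX)) (by positivity)

lemma expect_nonneg {p : ℝ} (hp0 : 0 ≤ p) (hp1 : p ≤ 1) {Ω : Finset ℕ} {f : Finset ℕ → ℝ}
    (hf : ∀ X, 0 ≤ f X) : 0 ≤ expect p Ω f := by
  have : 0 ≤ 1 - p := by linarith
  exact Finset.sum_nonneg fun X _ => mul_nonneg (by positivity) (hf X)

lemma expect_add (p : ℝ) (Ω : Finset ℕ) (f h : Finset ℕ → ℝ) :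
    expect p Ω (fun X => f X + h X) = expect p Ω f + expect p Ω h := by
  simp only [expect, mul_add, Finset.sum_add_distrib]

lemma expect_const_mul (p c : ℝ) (Ω : Finset ℕ) (f : Finset ℕ → ℝ) :
    expect p Ω (fun X => c * f X) = c * expect p Ω f := by
  simp only [expect, Finset.mul_sum]
  exact Finset.sum_congr rfl fun X _ => by ring

lemma expect_sum {ι : Type*} (p : ℝ) (Ω : Finset ℕ) (s : Finset ι) (f : ι → Finset ℕ → ℝ) :
    expect p Ω (fun X => ∑ i ∈ s, f i X) = ∑ i ∈ s, expect p Ω (f i) := by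
  simp only [expect, Finset.mul_sum]
  exact Finset.sum_comm

lemma expect_insert {p : ℝ} {Ω : Finset ℕ} {x : ℕ} (hx : x ∉ Ω) (f : Finset ℕ → ℝ) :
    expect p (insert x Ω) f =
      (1 - p) * expect p Ω f + p * expect p Ω (fun X => f (insert x X)) := by
  unfold expect
  rw [Finset.sum_powerset_insert hx, Finset.mul_sum, Finset.mul_sum]
  congr 1
  · refine Finset.sum_congr rfl fun X hX => ?_
    have h := Finset.card_le_card (Finset.mem_powerset.1 hX)
    rw [Finset.card_insert_of_notMem hx, Nat.succ_sub h, pow_succ]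
    ring
  · refine Finset.sum_congr rfl fun X hX => ?_
    have hxX : x ∉ X := fun h => hx (Finset.mem_powerset.1 hX h)
    rw [Finset.card_insert_of_notMem hx, Finset.card_insert_of_notMem hxX,
      Nat.add_sub_add_right, pow_succ]
    ring

lemma expect_empty (p : ℝ) (f : Finset ℕ → ℝ) : expect p ∅ f = f ∅ := by
  simp [expect]

/-- Harris' inequality for an antitone function and the event `F ⊆ X`. -/
lemma expect_mul_subset_le {p : ℝ} (hp0 : 0 ≤ p) (hp1 : p ≤ 1) (Ω : Finset ℕ) :
    ∀ (F : Finset ℕ) (f : Finset ℕ → ℝ), (∀ X, 0 ≤ f X) → Antitone f →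
      expect p Ω (fun X => f X * ind (fun Y => F ⊆ Y) X) ≤ p ^ F.card * expect p Ω f := by
  induction Ω using Finset.induction_on with
  | empty =>
    intro F f hf _
    rw [expect_empty, expect_empty]
    rcases F.eq_empty_or_nonempty with rfl | hF
    · simp [ind]
    · rw [ind_of_not (by simpa [Finset.subset_empty] using hF.ne_empty), mul_zero]
      exact mul_nonneg (by positivity) (hf _)
  | insert x Ω hx ih =>
    intro F f hf hanti
    have hanti' : Antitone fun X => f (insert x X) :=
      fun X Y h => hanti (Finset.insert_subset_insert x h)
    have h1 : 0 ≤ 1 - p := by linarith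
    rw [expect_insert hx, expect_insert hx]
    by_cases hxF : x ∈ F
    · have e1 : expect p Ω (fun X => f X * ind (fun Y => F ⊆ Y) X) ≤ expect p Ω fun _ => 0 := by
        refine expect_mono hp0 hp1 fun X hX => ?_
        rw [ind_of_not (fun h => hx (hX (h hxF))), mul_zero]
      have e0 : expect p Ω (fun _ => (0 : ℝ)) = 0 := by simp [expect]
      have e2 : expect p Ω (fun X => f (insert x X) * ind (fun Y => F ⊆ Y) (insert x X)) ≤
          p ^ (F.erase x).card * expect p Ω (fun X => f (insert x X)) := by
        refine le_trans (expect_mono hp0 hp1 fun X _ => ?_)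
          (ih (F.erase x) _ (fun X => hf _) hanti')
        refine mul_le_mul_of_nonneg_left (le_of_eq (ind_congr ?_)) (hf _)
        exact Finset.subset_insert_iff
      have e3 : expect p Ω (fun X => f (insert x X)) ≤ expect p Ω f :=
        expect_mono hp0 hp1 fun X _ => hanti (Finset.subset_insert x X)
      have hc : p ^ F.card = p * p ^ (F.erase x).card := by
        rw [← pow_succ', Finset.card_erase_add_one hxF]
      have hq : 0 ≤ p * p ^ (F.erase x).card := by positivity
      rw [hc]
      rw [e0] at e1
      nlinarith [mul_le_mul_of_nonneg_left e1 h1, mul_le_mul_of_nonneg_left e2 hp0,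
        mul_le_mul_of_nonneg_left e3 (mul_nonneg hq h1)]
    · have e1 := ih F f hf hanti
      have e2 : expect p Ω (fun X => f (insert x X) * ind (fun Y => F ⊆ Y) (insert x X)) ≤
          p ^ F.card * expect p Ω (fun X => f (insert x X)) := by
        refine le_trans (expect_mono hp0 hp1 fun X _ => ?_) (ih F _ (fun X => hf _) hanti')
        refine mul_le_mul_of_nonneg_left (le_of_eq (ind_congr ?_)) (hf _)
        exact Finset.subset_insert_iff_of_notMem hxF
      nlinarith [mul_le_mul_of_nonneg_left e1 h1, mul_le_mul_of_nonneg_left e2 hp0]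

lemma antitone_ind {E : Finset ℕ → Prop} (hE : Antitone E) : Antitone (ind E) := by
  intro X Y h
  by_cases hY : E Y
  · rw [ind_of hY, ind_of (hE h hY)]
  · rw [ind_of_not hY]; exact ind_nonneg _ _

/-- Conditionally on a decreasing event `E`, the random set contains a new element with probability
at least `p / 2`, so it misses `W` with probability at most `(1 - p / 2) ^ |W|`. -/
lemma expect_miss_le {p : ℝ} (hp0 : 0 ≤ p) (hp1 : p ≤ 1) {E : Finset ℕ → Prop} {Ω : Finset ℕ}
    (hH : ∀ Ω' ⊆ Ω, ∀ x ∈ Ω, x ∉ Ω' → expect p Ω' (ind fun X => E X ∧ ¬E (insert x X)) ≤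
      1 / 2 * expect p Ω' (ind E)) :
    ∀ (W Ω' : Finset ℕ), W ⊆ Ω' → Ω' ⊆ Ω → expect p Ω' (ind fun X => E X ∧ Disjoint X W) ≤
      (1 - p / 2) ^ W.card * expect p Ω' (ind E) := by
  intro W
  induction W using Finset.induction_on with
  | empty => intro Ω' _ _; simp
  | insert x W hx ih =>
    intro Ω' hW hΩ'
    have hxΩ : x ∈ Ω' := hW (Finset.mem_insert_self _ _)
    obtain ⟨Ω₁, hxΩ₁, rfl⟩ : ∃ Ω₁, x ∉ Ω₁ ∧ insert x Ω₁ = Ω' :=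
      ⟨Ω'.erase x, Finset.notMem_erase _ _, Finset.insert_erase hxΩ⟩
    have hsub : Ω₁ ⊆ Ω := (Finset.subset_insert _ _).trans hΩ'
    have hWΩ : W ⊆ Ω₁ := by
      intro y hy
      rcases Finset.mem_insert.1 (hW (Finset.mem_insert_of_mem hy)) with rfl | h
      · exact absurd hy hx
      · exact h
    have h1 := ih Ω₁ hWΩ hsub
    have h2 := hH Ω₁ hsub x (hΩ' hxΩ) hxΩ₁
    rw [expect_insert hxΩ₁, expect_insert hxΩ₁, Finset.card_insert_of_notMem hx, pow_succ]
    have e1 : expect p Ω₁ (fun X => ind (fun X => E X ∧ Disjoint X (insert x W)) (insert x X)) ≤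
        expect p Ω₁ fun _ => 0 := by
      refine expect_mono hp0 hp1 fun X _ => ?_
      rw [ind_of_not]
      rintro ⟨-, h⟩
      exact Finset.disjoint_left.1 h (Finset.mem_insert_self _ _) (Finset.mem_insert_self _ _)
    have e0 : expect p Ω₁ (fun _ => (0 : ℝ)) = 0 := by simp [expect]
    have e2 : expect p Ω₁ (ind fun X => E X ∧ Disjoint X (insert x W)) ≤
        expect p Ω₁ (ind fun X => E X ∧ Disjoint X W) := by
      refine expect_mono hp0 hp1 fun X _ => ?_
      by_cases h : E X ∧ Disjoint X (insert x W)
      · rw [ind_of h, ind_of ⟨h.1, h.2.mono_right (Finset.subset_insert _ _)⟩]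
      · rw [ind_of_not h]; exact ind_nonneg _ _
    have e3 : expect p Ω₁ (ind E) ≤ expect p Ω₁ (fun X => ind E (insert x X)) +
        expect p Ω₁ (ind fun X => E X ∧ ¬E (insert x X)) := by
      rw [← expect_add]
      refine expect_mono hp0 hp1 fun X _ => ?_
      by_cases h : E X
      · by_cases h' : E (insert x X)
        · rw [ind_of h, ind_of h']; linarith [ind_nonneg (fun X => E X ∧ ¬E (insert x X)) X]
        · rw [ind_of h, ind_of_not h', ind_of ⟨h, h'⟩]; norm_num
      · rw [ind_of_not h]
        exact add_nonneg (ind_nonneg _ _) (ind_nonneg _ _)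
    have hZ : 0 ≤ expect p Ω₁ (ind E) := expect_nonneg hp0 hp1 (ind_nonneg E)
    have hq : 0 ≤ (1 - p / 2) ^ W.card := pow_nonneg (by linarith) _
    rw [e0] at e1
    have h1p : 0 ≤ 1 - p := by linarith
    have hh : 0 ≤ 1 - p / 2 := by linarith
    have k1 : (1 - p / 2) * expect p Ω₁ (ind E) ≤
        (1 - p) * expect p Ω₁ (ind E) + p * expect p Ω₁ (fun X => ind E (insert x X)) := by
      nlinarith [mul_le_mul_of_nonneg_left (e3.trans (add_le_add_right h2 _)) hp0]
    have k2 : (1 - p) * ((1 - p / 2) ^ W.card * expect p Ω₁ (ind E)) ≤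
        (1 - p / 2) ^ W.card * ((1 - p / 2) * ((1 - p / 2) * expect p Ω₁ (ind E))) := by
      have : 0 ≤ (1 - p / 2) ^ W.card * expect p Ω₁ (ind E) := mul_nonneg hq hZ
      nlinarith [mul_nonneg this (sq_nonneg p)]
    have k3 := mul_le_mul_of_nonneg_left (mul_le_mul_of_nonneg_left k1 hh) hq
    nlinarith [mul_le_mul_of_nonneg_left (e2.trans h1) h1p, mul_le_mul_of_nonneg_left e1 hp0]

/-! ### Adding one element to a random `B₂[g]` set -/

/-- The ordered representations of `m` as a sum of two elements of `A`. -/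
def reps (A : Finset ℕ) (m : ℕ) : Finset (ℕ × ℕ) :=
  (A ×ˢ A).filter fun r => r.1 ≤ r.2 ∧ r.1 + r.2 = m

lemma mem_reps {A : Finset ℕ} {m : ℕ} {r : ℕ × ℕ} :
    r ∈ reps A m ↔ r.1 ∈ A ∧ r.2 ∈ A ∧ r.1 ≤ r.2 ∧ r.1 + r.2 = m := by
  simp [reps, and_assoc]

lemma rA_coe (A : Finset ℕ) (m : ℕ) : rA (A : Set ℕ) m = (reps A m).card := by
  rw [rA, ← Set.ncard_coe_finset]
  congr 1
  ext r
  simp [mem_reps]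

lemma isB2g_coe {A : Finset ℕ} {g : ℕ} :
    IsB2g (A : Set ℕ) g ↔ ∀ m, (reps A m).card ≤ g := by
  simp only [IsB2g, rA_coe]

lemma reps_mono {A B : Finset ℕ} (h : A ⊆ B) (m : ℕ) : reps A m ⊆ reps B m := by
  intro r hr
  rw [mem_reps] at hr ⊢
  exact ⟨h hr.1, h hr.2.1, hr.2.2⟩

lemma antitone_isB2g_union (O : Finset ℕ) (g : ℕ) :
    Antitone fun X : Finset ℕ => IsB2g (↑(O ∪ X) : Set ℕ) g := by
  intro X Y h hY
  simp only [isB2g_coe] at hY ⊢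
  exact fun m =>
    (Finset.card_le_card (reps_mono (Finset.union_subset_union_right h) m)).trans (hY m)

lemma sum_powersetCard_prod_le {ι : Type*} [DecidableEq ι] (a : ι → ℝ) (ha : ∀ i, 0 ≤ a i)
    (T : Finset ι) :
    ∀ g : ℕ, ∑ G ∈ T.powersetCard g, ∏ i ∈ G, a i ≤ (∑ i ∈ T, a i) ^ g := by
  induction T using Finset.induction_on with
  | empty =>
    rintro (_ | g)
    · simp
    · rw [Finset.powersetCard_eq_empty.2 (by simp)]; simp
  | insert x T hx ih =>
    rintro (_ | g)
    · simp
    · have hS : 0 ≤ ∑ i ∈ T, a i := Finset.sum_nonneg fun i _ => ha i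
      have hd : Disjoint (T.powersetCard (g + 1)) ((T.powersetCard g).image (insert x)) := by
        rw [Finset.disjoint_left]
        intro G hG hG'
        obtain ⟨G', -, rfl⟩ := Finset.mem_image.1 hG'
        exact hx ((Finset.mem_powersetCard.1 hG).1 (Finset.mem_insert_self _ _))
      have hnot : ∀ G ∈ T.powersetCard g, x ∉ G := fun G hG h =>
        hx ((Finset.mem_powersetCard.1 hG).1 h)
      rw [Finset.powersetCard_succ_insert hx, Finset.sum_union hd, Finset.sum_image,
        Finset.sum_insert hx]
      · have e : ∑ G ∈ T.powersetCard g, ∏ i ∈ insert x G, a i =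
            a x * ∑ G ∈ T.powersetCard g, ∏ i ∈ G, a i := by
          rw [Finset.mul_sum]
          exact Finset.sum_congr rfl fun G hG => Finset.prod_insert (hnot G hG)
        rw [e]
        have h1 := ih (g + 1)
        have h2 := mul_le_mul_of_nonneg_left (ih g) (ha x)
        have h3 : (∑ i ∈ T, a i) ^ g ≤ (a x + ∑ i ∈ T, a i) ^ g :=
          pow_le_pow_left₀ hS (by linarith [ha x]) g
        have h4 := mul_le_mul_of_nonneg_right h3 (add_nonneg (ha x) hS)
        rw [pow_succ] at h1 ⊢
        nlinarith
      · intro G hG G' hG' h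
        rw [← Finset.erase_insert (hnot G hG), ← Finset.erase_insert (hnot G' hG'), h]

/-- The part of a representation that lies in `Ω`. -/
def repSupp (Ω : Finset ℕ) (r : ℕ × ℕ) : Finset ℕ := ({r.1, r.2} : Finset ℕ) ∩ Ω

/-- The representations of `m` in `O ∪ Ω` which involve an element of `Ω`. -/
def mixedReps (O Ω : Finset ℕ) (m : ℕ) : Finset (ℕ × ℕ) :=
  (reps (O ∪ Ω) m).filter fun r => r.1 ∈ Ω ∨ r.2 ∈ Ω

lemma mem_repSupp {Ω : Finset ℕ} {r : ℕ × ℕ} {a : ℕ} :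
    a ∈ repSupp Ω r ↔ (a = r.1 ∨ a = r.2) ∧ a ∈ Ω := by
  simp [repSupp]

lemma sum_mixedReps_le {p : ℝ} (hp0 : 0 ≤ p) (hp1 : p ≤ 1) (O Ω : Finset ℕ) (m : ℕ) :
    ∑ r ∈ mixedReps O Ω m, p ^ (repSupp Ω r).card ≤
      p * (2 * O.card + 1 + p * Ω.card) := by
  set T := mixedReps O Ω m with hTdef
  have hT : ∀ r ∈ T, (r.1 ∈ O ∨ r.1 ∈ Ω) ∧ (r.2 ∈ O ∨ r.2 ∈ Ω) ∧ r.1 + r.2 = m ∧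
      (r.1 ∈ Ω ∨ r.2 ∈ Ω) := by
    intro r hr
    have := Finset.mem_filter.1 hr
    have h2 := mem_reps.1 this.1
    simp only [Finset.mem_union] at h2
    exact ⟨h2.1, h2.2.1, h2.2.2.2, this.2⟩
  have hinj1 : ∀ r ∈ T, ∀ r' ∈ T, r.1 = r'.1 → r = r' := fun r hr r' hr' h =>
    Prod.ext h (by have := (hT r hr).2.2.1; have := (hT r' hr').2.2.1; omega)
  have hinj2 : ∀ r ∈ T, ∀ r' ∈ T, r.2 = r'.2 → r = r' := fun r hr r' hr' h =>
    Prod.ext (by have := (hT r hr).2.2.1; have := (hT r' hr').2.2.1; omega) h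
  have c1 : (T.filter fun r => r.1 ∈ O).card ≤ O.card :=
    Finset.card_le_card_of_injOn Prod.fst (fun r hr => (Finset.mem_filter.1 hr).2)
      fun r hr r' hr' h => hinj1 r (Finset.mem_filter.1 hr).1 r' (Finset.mem_filter.1 hr').1 h
  have c2 : (T.filter fun r => r.2 ∈ O).card ≤ O.card :=
    Finset.card_le_card_of_injOn Prod.snd (fun r hr => (Finset.mem_filter.1 hr).2)
      fun r hr r' hr' h => hinj2 r (Finset.mem_filter.1 hr).1 r' (Finset.mem_filter.1 hr').1 h
  have c3 : (T.filter fun r => r.1 = r.2).card ≤ 1 := by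
    refine Finset.card_le_one.2 fun r hr r' hr' => ?_
    have h1 := Finset.mem_filter.1 hr
    have h2 := Finset.mem_filter.1 hr'
    have := (hT r h1.1).2.2.1
    have := (hT r' h2.1).2.2.1
    exact Prod.ext (by omega) (by omega)
  have c4 : (T.filter fun r => r.1 ∈ Ω).card ≤ Ω.card :=
    Finset.card_le_card_of_injOn Prod.fst (fun r hr => (Finset.mem_filter.1 hr).2)
      fun r hr r' hr' h => hinj1 r (Finset.mem_filter.1 hr).1 r' (Finset.mem_filter.1 hr').1 h
  have key : ∀ r ∈ T, p ^ (repSupp Ω r).card ≤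
      p * (if r.1 ∈ O then 1 else 0) + p * (if r.2 ∈ O then 1 else 0) +
        p * (if r.1 = r.2 then 1 else 0) + p ^ 2 * (if r.1 ∈ Ω then 1 else 0) := by
    intro r hr
    obtain ⟨h1, h2, -, h4⟩ := hT r hr
    have hpos : 1 ≤ (repSupp Ω r).card := by
      refine Finset.card_pos.2 ?_
      rcases h4 with h | h
      · exact ⟨r.1, mem_repSupp.2 ⟨Or.inl rfl, h⟩⟩
      · exact ⟨r.2, mem_repSupp.2 ⟨Or.inr rfl, h⟩⟩
    have hle : p ^ (repSupp Ω r).card ≤ p := by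
      simpa using pow_le_pow_of_le_one hp0 hp1 hpos
    have n1 : 0 ≤ p * (if r.1 ∈ O then 1 else 0) := by positivity
    have n2 : 0 ≤ p * (if r.2 ∈ O then 1 else 0) := by positivity
    have n3 : 0 ≤ p * (if r.1 = r.2 then 1 else 0) := by positivity
    have n4 : 0 ≤ p ^ 2 * (if r.1 ∈ Ω then 1 else 0) := by positivity
    by_cases a1 : r.1 ∈ O
    · rw [if_pos a1] at *; linarith
    by_cases a2 : r.2 ∈ O
    · rw [if_pos a2] at *; linarith
    by_cases a3 : r.1 = r.2
    · rw [if_pos a3] at *; linarith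
    have b1 := h1.resolve_left a1
    have b2 := h2.resolve_left a2
    have : repSupp Ω r = {r.1, r.2} := by
      rw [repSupp, Finset.inter_eq_left]
      intro a ha
      rcases Finset.mem_insert.1 ha with rfl | h
      · exact b1
      · rw [Finset.mem_singleton.1 h]; exact b2
    rw [this, Finset.card_pair a3]
    rw [if_pos b1] at *
    linarith
  refine (Finset.sum_le_sum key).trans ?_
  simp only [Finset.sum_add_distrib, ← Finset.mul_sum, Finset.sum_boole]
  have d1 : ((T.filter fun r => r.1 ∈ O).card : ℝ) ≤ O.card := by exact_mod_cast c1
  have d2 : ((T.filter fun r => r.2 ∈ O).card : ℝ) ≤ O.card := by exact_mod_cast c2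
  have d3 : ((T.filter fun r => r.1 = r.2).card : ℝ) ≤ 1 := by exact_mod_cast c3
  have d4 : ((T.filter fun r => r.1 ∈ Ω).card : ℝ) ≤ Ω.card := by exact_mod_cast c4
  have hp2 : 0 ≤ p ^ 2 := by positivity
  nlinarith [mul_le_mul_of_nonneg_left d1 hp0, mul_le_mul_of_nonneg_left d2 hp0,
    mul_le_mul_of_nonneg_left d3 hp0, mul_le_mul_of_nonneg_left d4 hp2]

/-- The elements that must be chosen for `x` to create more than `g` representations of `x + z`,
where `G` is a family of `g` old representations. -/
def obstruction (Ω : Finset ℕ) (z : ℕ) (G : Finset (ℕ × ℕ)) : Finset ℕ :=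
  ({z} ∩ Ω) ∪ G.biUnion (repSupp Ω)

lemma card_obstruction {O Ω : Finset ℕ} {x z : ℕ} {G : Finset (ℕ × ℕ)} (hxO : x ∉ O)
    (hxΩ : x ∉ Ω) (hG : G ⊆ mixedReps O Ω (x + z)) :
    (obstruction Ω z G).card = ({z} ∩ Ω).card + ∑ r ∈ G, (repSupp Ω r).card := by
  have hG' : ∀ r ∈ G, (r.1 ∈ O ∪ Ω) ∧ (r.2 ∈ O ∪ Ω) ∧ r.1 ≤ r.2 ∧ r.1 + r.2 = x + z :=
    fun r hr => mem_reps.1 (Finset.mem_filter.1 (hG hr)).1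
  have hx : x ∉ O ∪ Ω := by simp [hxO, hxΩ]
  rw [obstruction, Finset.card_union_of_disjoint, Finset.card_biUnion]
  · intro r hr r' hr' hne
    refine Finset.disjoint_left.2 ?_
    intro a ha ha'
    have h1 := (mem_repSupp.1 ha).1
    have h2 := (mem_repSupp.1 ha').1
    have h3 := hG' r hr
    have h4 := hG' r' hr'
    exact hne (Prod.ext (by omega) (by omega))
  · rw [Finset.disjoint_left]
    intro a ha ha'
    obtain ⟨r, hr, har⟩ := Finset.mem_biUnion.1 ha'
    have h0 : a = z := Finset.mem_singleton.1 (Finset.mem_inter.1 ha).1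
    obtain ⟨h1, h2, -, h4⟩ := hG' r hr
    rcases (mem_repSupp.1 har).1 with h | h
    · exact hx ((by omega : r.2 = x) ▸ h2)
    · exact hx ((by omega : r.1 = x) ▸ h1)

lemma exists_obstruction {O Ω X : Finset ℕ} {x g : ℕ} (hX : X ⊆ Ω) (hdisj : Disjoint O Ω)
    (hxΩ : x ∉ Ω)
    (hsep : ∀ z ∈ insert x (O ∪ Ω), ∀ z₁ ∈ O, ∀ z₂ ∈ O, x + z ≠ z₁ + z₂)
    (h1 : IsB2g (↑(O ∪ X) : Set ℕ) g) (h2 : ¬IsB2g (↑(O ∪ insert x X) : Set ℕ) g) :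
    ∃ z ∈ insert x (O ∪ Ω), ∃ G ∈ (mixedReps O Ω (x + z)).powersetCard g,
      obstruction Ω z G ⊆ X := by
  rw [isB2g_coe] at h1 h2
  push Not at h2
  obtain ⟨m, hm⟩ := h2
  have hm1 := h1 m
  have hOX : ∀ a, a ∈ O ∪ X → a ∈ O ∪ Ω := fun a ha => Finset.union_subset_union_right hX ha
  have hXΩ : ∀ a, a ∈ O ∪ X → a ∈ Ω → a ∈ X := fun a ha haΩ =>
    (Finset.mem_union.1 ha).resolve_left fun h => Finset.disjoint_left.1 hdisj h haΩ
  have hmem : ∀ a, a ∈ O ∪ insert x X ↔ a = x ∨ a ∈ O ∪ X := by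
    intro a; simp only [Finset.mem_union, Finset.mem_insert]; tauto
  have hinv : ∀ r ∈ reps (O ∪ insert x X) m, r ∉ reps (O ∪ X) m → r.1 = x ∨ r.2 = x := by
    intro r hr hr'
    rw [mem_reps] at hr hr'
    rw [hmem, hmem] at hr
    tauto
  obtain ⟨r, hr, hr'⟩ : ∃ r ∈ reps (O ∪ insert x X) m, r ∉ reps (O ∪ X) m :=
    Finset.exists_mem_notMem_of_card_lt_card (hm1.trans_lt hm)
  have hsub : reps (O ∪ insert x X) m ⊆ insert r (reps (O ∪ X) m) := by
    intro s hs
    by_cases hs' : s ∈ reps (O ∪ X) m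
    · exact Finset.mem_insert_of_mem hs'
    · have a1 := hinv r hr hr'
      have a2 := hinv s hs hs'
      have a3 := (mem_reps.1 hr).2.2
      have a4 := (mem_reps.1 hs).2.2
      rw [show s = r from Prod.ext (by omega) (by omega)]
      exact Finset.mem_insert_self _ _
  have hcard : g ≤ (reps (O ∪ X) m).card := by
    have := (Finset.card_le_card hsub).trans (Finset.card_insert_le _ _)
    omega
  obtain ⟨z, hz, hzm⟩ : ∃ z, (z = x ∨ z ∈ O ∪ X) ∧ x + z = m := by
    have a3 := mem_reps.1 hr
    rw [hmem, hmem] at a3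
    rcases hinv r hr hr' with h | h
    · exact ⟨r.2, a3.2.1, by omega⟩
    · exact ⟨r.1, a3.1, by omega⟩
  have hz' : z ∈ insert x (O ∪ Ω) := by
    rcases hz with h | h
    · exact h ▸ Finset.mem_insert_self _ _
    · exact Finset.mem_insert_of_mem (hOX z h)
  obtain ⟨G, hG, hGc⟩ := Finset.exists_subset_card_eq hcard
  refine ⟨z, hz', G, Finset.mem_powersetCard.2 ⟨fun s hs => ?_, hGc⟩, ?_⟩
  · obtain ⟨b1, b2, b3, b4⟩ := mem_reps.1 (hG hs)
    refine Finset.mem_filter.2 ⟨mem_reps.2 ⟨hOX _ b1, hOX _ b2, b3, b4.trans hzm.symm⟩, ?_⟩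
    by_contra! hcon
    have c1 : s.1 ∈ O := (Finset.mem_union.1 (hOX _ b1)).resolve_right hcon.1
    have c2 : s.2 ∈ O := (Finset.mem_union.1 (hOX _ b2)).resolve_right hcon.2
    exact hsep z hz' _ c1 _ c2 (hzm.trans b4.symm)
  · intro a ha
    rcases Finset.mem_union.1 ha with h | h
    · have h0 := Finset.mem_inter.1 h
      have h1 : a = z := Finset.mem_singleton.1 h0.1
      subst h1
      exact hXΩ a (hz.resolve_left fun h => hxΩ (h ▸ h0.2)) h0.2
    · obtain ⟨s, hs, has⟩ := Finset.mem_biUnion.1 h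
      obtain ⟨b1, b2, -⟩ := mem_reps.1 (hG hs)
      obtain ⟨c1, c2⟩ := mem_repSupp.1 has
      rcases c1 with rfl | rfl
      · exact hXΩ _ b1 c2
      · exact hXΩ _ b2 c2

lemma sum_pow_card_singleton_inter_le {p : ℝ} (hp0 : 0 ≤ p) (hp1 : p ≤ 1) (O Ω : Finset ℕ)
    (x : ℕ) : ∑ z ∈ insert x (O ∪ Ω), p ^ (({z} : Finset ℕ) ∩ Ω).card ≤
      O.card + 1 + p * Ω.card := by
  have hle : ∀ z, p ^ (({z} : Finset ℕ) ∩ Ω).card ≤ 1 := fun z => pow_le_one₀ hp0 hp1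
  have hnn : ∀ z, 0 ≤ p ^ (({z} : Finset ℕ) ∩ Ω).card := fun z => pow_nonneg hp0 _
  have h1 : ∑ z ∈ insert x (O ∪ Ω), p ^ (({z} : Finset ℕ) ∩ Ω).card ≤
      ∑ z ∈ {x}, p ^ (({z} : Finset ℕ) ∩ Ω).card +
        (∑ z ∈ O, p ^ (({z} : Finset ℕ) ∩ Ω).card + ∑ z ∈ Ω, p ^ (({z} : Finset ℕ) ∩ Ω).card) := by
    rw [← Finset.sum_union_inter (s₁ := O), Finset.insert_eq]
    have := Finset.sum_union_inter (s₁ := {x}) (s₂ := O ∪ Ω)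
      (f := fun z => p ^ (({z} : Finset ℕ) ∩ Ω).card)
    have := Finset.sum_nonneg fun z (_ : z ∈ O ∩ Ω) => hnn z
    have := Finset.sum_nonneg fun z (_ : z ∈ {x} ∩ (O ∪ Ω)) => hnn z
    linarith
  have h2 : ∑ z ∈ O, p ^ (({z} : Finset ℕ) ∩ Ω).card ≤ O.card := by
    simpa using Finset.sum_le_card_nsmul O _ 1 fun z _ => hle z
  have h3 : ∑ z ∈ Ω, p ^ (({z} : Finset ℕ) ∩ Ω).card = p * Ω.card := by
    rw [Finset.sum_congr rfl (g := fun _ => p)]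
    · simp [mul_comm]
    · intro z hz
      rw [Finset.singleton_inter_of_mem hz, Finset.card_singleton, pow_one]
  rw [Finset.sum_singleton] at h1
  linarith [hle x]

/-- If the random set is small, then conditionally on being `B₂[g]` it stays so
with probability at least `1 / 2` after the insertion of a new element. -/
lemma expect_break_le {p : ℝ} (hp0 : 0 ≤ p) (hp1 : p ≤ 1) {O Ω : Finset ℕ} {g : ℕ}
    (hdisj : Disjoint O Ω)
    (hsep : ∀ x ∈ Ω, ∀ z ∈ O ∪ Ω, ∀ z₁ ∈ O, ∀ z₂ ∈ O, x + z ≠ z₁ + z₂)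
    (hnum : p ^ g * (2 * O.card + 1 + p * Ω.card) ^ (g + 1) ≤ 1 / 2) :
    ∀ Ω' ⊆ Ω, ∀ x ∈ Ω, x ∉ Ω' →
      expect p Ω' (ind fun X => IsB2g (↑(O ∪ X) : Set ℕ) g ∧
        ¬IsB2g (↑(O ∪ insert x X) : Set ℕ) g) ≤
      1 / 2 * expect p Ω' (ind fun X => IsB2g (↑(O ∪ X) : Set ℕ) g) := by
  intro Ω' hΩ' x hx hxΩ'
  set E : Finset ℕ → Prop := fun X => IsB2g (↑(O ∪ X) : Set ℕ) g with hE
  set Z := expect p Ω' (ind E) with hZ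
  have hZ0 : 0 ≤ Z := expect_nonneg hp0 hp1 (ind_nonneg _)
  have hdisj' : Disjoint O Ω' := hdisj.mono_right hΩ'
  have hxO : x ∉ O := fun h => Finset.disjoint_left.1 hdisj h hx
  have hsep' : ∀ z ∈ insert x (O ∪ Ω'), ∀ z₁ ∈ O, ∀ z₂ ∈ O, x + z ≠ z₁ + z₂ := by
    intro z hz
    refine hsep x hx z ?_
    rcases Finset.mem_insert.1 hz with rfl | h
    · exact Finset.mem_union_right _ hx
    · exact Finset.union_subset_union_right hΩ' h
  set h : ℝ := 2 * O.card + 1 + p * Ω.card with hh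
  have hh0 : 0 ≤ h := by positivity
  have hcardΩ : (Ω'.card : ℝ) ≤ Ω.card := by exact_mod_cast Finset.card_le_card hΩ'
  have hpΩ := mul_le_mul_of_nonneg_left hcardΩ hp0
  calc expect p Ω' (ind fun X => E X ∧ ¬E (insert x X))
      ≤ expect p Ω' (fun X => ∑ z ∈ insert x (O ∪ Ω'),
          ∑ G ∈ (mixedReps O Ω' (x + z)).powersetCard g,
            ind E X * ind (fun Y => obstruction Ω' z G ⊆ Y) X) := by
        refine expect_mono hp0 hp1 fun X hX => ?_
        have hnn : ∀ z G, 0 ≤ ind E X * ind (fun Y => obstruction Ω' z G ⊆ Y) X :=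
          fun z G => mul_nonneg (ind_nonneg _ _) (ind_nonneg _ _)
        by_cases hX2 : E X ∧ ¬E (insert x X)
        · obtain ⟨z, hz, G, hG, hsub⟩ := exists_obstruction hX hdisj' hxΩ' hsep' hX2.1 hX2.2
          have e : ind E X * ind (fun Y => obstruction Ω' z G ⊆ Y) X = 1 := by
            rw [ind_of hX2.1, ind_of hsub, mul_one]
          rw [ind_of hX2, ← e]
          exact (Finset.single_le_sum (f := fun G => ind E X *
            ind (fun Y => obstruction Ω' z G ⊆ Y) X) (fun G _ => hnn z G) hG).trans
            (Finset.single_le_sum (f := fun z => ∑ G ∈ (mixedReps O Ω' (x + z)).powersetCard g,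
            ind E X * ind (fun Y => obstruction Ω' z G ⊆ Y) X)
            (fun z _ => Finset.sum_nonneg fun G _ => hnn z G) hz)
        · rw [ind_of_not hX2]
          exact Finset.sum_nonneg fun z _ => Finset.sum_nonneg fun G _ => hnn z G
    _ = ∑ z ∈ insert x (O ∪ Ω'), ∑ G ∈ (mixedReps O Ω' (x + z)).powersetCard g,
          expect p Ω' (fun X => ind E X * ind (fun Y => obstruction Ω' z G ⊆ Y) X) := by
        rw [expect_sum]
        exact Finset.sum_congr rfl fun z _ => expect_sum _ _ _ _
    _ ≤ ∑ z ∈ insert x (O ∪ Ω'), ∑ G ∈ (mixedReps O Ω' (x + z)).powersetCard g,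
          p ^ (({z} : Finset ℕ) ∩ Ω').card * (∏ r ∈ G, p ^ (repSupp Ω' r).card) * Z := by
        refine Finset.sum_le_sum fun z _ => Finset.sum_le_sum fun G hG => ?_
        refine (expect_mul_subset_le hp0 hp1 Ω' (obstruction Ω' z G) (ind E) (ind_nonneg E)
          (antitone_ind (antitone_isB2g_union O g))).trans_eq ?_
        rw [card_obstruction hxO hxΩ' (Finset.mem_powersetCard.1 hG).1, pow_add,
          Finset.prod_pow_eq_pow_sum]
    _ = (∑ z ∈ insert x (O ∪ Ω'), p ^ (({z} : Finset ℕ) ∩ Ω').card *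
          ∑ G ∈ (mixedReps O Ω' (x + z)).powersetCard g, ∏ r ∈ G, p ^ (repSupp Ω' r).card) *
            Z := by
        simp only [Finset.mul_sum, Finset.sum_mul]
    _ ≤ (∑ z ∈ insert x (O ∪ Ω'), p ^ (({z} : Finset ℕ) ∩ Ω').card * (p * h) ^ g) * Z := by
        refine mul_le_mul_of_nonneg_right (Finset.sum_le_sum fun z _ => ?_) hZ0
        refine mul_le_mul_of_nonneg_left ?_ (pow_nonneg hp0 _)
        refine (sum_powersetCard_prod_le _ (fun r => pow_nonneg hp0 _) _ g).trans ?_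
        refine pow_le_pow_left₀ (Finset.sum_nonneg fun r _ => pow_nonneg hp0 _)
          ((sum_mixedReps_le hp0 hp1 O Ω' _).trans ?_) g
        exact mul_le_mul_of_nonneg_left (by rw [hh]; linarith) hp0
    _ ≤ h * (p * h) ^ g * Z := by
        rw [← Finset.sum_mul]
        refine mul_le_mul_of_nonneg_right (mul_le_mul_of_nonneg_right ?_ (by positivity)) hZ0
        refine (sum_pow_card_singleton_inter_le hp0 hp1 O Ω' x).trans ?_
        have : (0 : ℝ) ≤ O.card := by positivity
        rw [hh]; linarith
    _ = p ^ g * h ^ (g + 1) * Z := by rw [mul_pow, pow_succ]; ring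
    _ ≤ 1 / 2 * Z := mul_le_mul_of_nonneg_right hnum hZ0

/-! ### Existence of a good extension -/

lemma expect_half_pow_le {p : ℝ} (hp0 : 0 ≤ p) (hp1 : p ≤ 1) {E : Finset ℕ → Prop} {Ω C : Finset ℕ}
    (hH : ∀ Ω' ⊆ Ω, ∀ x ∈ Ω, x ∉ Ω' → expect p Ω' (ind fun X => E X ∧ ¬E (insert x X)) ≤
      1 / 2 * expect p Ω' (ind E)) (hC : C ⊆ Ω) :
    expect p Ω (fun X => ind E X * (1 / 2) ^ (X ∩ C).card) ≤
      (1 - p / 4) ^ C.card * expect p Ω (ind E) := by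
  have h2 : (0 : ℝ) < 2 ^ C.card := by positivity
  refine le_of_mul_le_mul_left ?_ h2
  rw [← expect_const_mul]
  calc expect p Ω (fun X => 2 ^ C.card * (ind E X * (1 / 2) ^ (X ∩ C).card))
      ≤ expect p Ω (fun X => ∑ W ∈ C.powerset, ind (fun X => E X ∧ Disjoint X W) X) := by
        refine expect_mono hp0 hp1 fun X _ => ?_
        by_cases hE : E X
        · have e1 : (2 : ℝ) ^ C.card * (ind E X * (1 / 2) ^ (X ∩ C).card) =
              ∑ W ∈ (C \ X).powerset, 1 := by
            rw [ind_of hE, one_mul, Finset.sum_const, Finset.card_powerset, nsmul_one,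
              ← Finset.card_sdiff_add_card_inter C X, Finset.inter_comm X C, pow_add, mul_assoc,
              ← mul_pow]
            norm_num
          rw [e1]
          refine (Finset.sum_le_sum fun W hW => ?_).trans
            (Finset.sum_le_sum_of_subset_of_nonneg
              (Finset.powerset_mono.2 Finset.sdiff_subset) fun W _ _ => ind_nonneg _ _)
          have hd : Disjoint X W :=
            (Finset.disjoint_sdiff (s := X) (t := C)).mono_right (Finset.mem_powerset.1 hW)
          exact (ind_of (E := fun X => E X ∧ Disjoint X W) ⟨hE, hd⟩).ge
        · rw [ind_of_not hE, zero_mul, mul_zero]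
          exact Finset.sum_nonneg fun W _ => ind_nonneg _ _
    _ = ∑ W ∈ C.powerset, expect p Ω (ind fun X => E X ∧ Disjoint X W) := expect_sum _ _ _ _
    _ ≤ ∑ W ∈ C.powerset, (1 - p / 2) ^ W.card * expect p Ω (ind E) :=
        Finset.sum_le_sum fun W hW => expect_miss_le hp0 hp1 hH W Ω
          ((Finset.mem_powerset.1 hW).trans hC) subset_rfl
    _ = 2 ^ C.card * ((1 - p / 4) ^ C.card * expect p Ω (ind E)) := by
        have := Finset.sum_pow_mul_eq_add_pow (1 - p / 2) 1 C
        simp only [one_pow, mul_one] at this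
        rw [← Finset.sum_mul, this, ← mul_assoc, ← mul_pow]
        congr 2
        ring

lemma expect_ind_pos {p : ℝ} (hp1 : p < 1) (hp0 : 0 ≤ p) {E : Finset ℕ → Prop}
    (Ω : Finset ℕ) (hE : E ∅) : 0 < expect p Ω (ind E) := by
  have h1 : 0 < 1 - p := by linarith
  refine lt_of_lt_of_le ?_ (Finset.single_le_sum (fun X _ => ?_) (Finset.empty_mem_powerset Ω))
  · rw [ind_of hE]
    simp only [Finset.card_empty, pow_zero, Nat.sub_zero, one_mul, mul_one]
    positivity
  · exact mul_nonneg (by positivity) (ind_nonneg _ _)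

/-- A finite `B₂[g]` set `O` can be extended by a subset of `Ω` that meets all the sets `W n`, has
many elements in the sets `C r`, and is not too large. -/
lemma exists_extension {p : ℝ} (hp0 : 0 ≤ p) (hp1 : p < 1) {O Ω : Finset ℕ} {g : ℕ}
    (hdisj : Disjoint O Ω)
    (hsep : ∀ x ∈ Ω, ∀ z ∈ O ∪ Ω, ∀ z₁ ∈ O, ∀ z₂ ∈ O, x + z ≠ z₁ + z₂)
    (hnum : p ^ g * (2 * O.card + 1 + p * Ω.card) ^ (g + 1) ≤ 1 / 2)
    (hO : IsB2g (O : Set ℕ) g) (I : Finset ℕ) (W : ℕ → Finset ℕ) (hW : ∀ n ∈ I, W n ⊆ Ω)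
    (hWsum : ∑ n ∈ I, (1 - p / 2) ^ (W n).card ≤ 1 / 4) (J : Finset ℕ) (C : ℕ → Finset ℕ)
    (hC : ∀ r ∈ J, C r ⊆ Ω) (k : ℕ) (hCsum : ∑ r ∈ J, 2 ^ k * (1 - p / 4) ^ (C r).card ≤ 1 / 4)
    {B : ℝ} (hB0 : 0 < B) (hB : p * Ω.card ≤ B / 4) :
    ∃ X ⊆ Ω, IsB2g (↑(O ∪ X) : Set ℕ) g ∧ (∀ n ∈ I, ∃ x ∈ X, x ∈ W n) ∧
      (∀ r ∈ J, k < (X ∩ C r).card) ∧ (X.card : ℝ) ≤ B := by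
  by_contra! hcon
  have hH := expect_break_le hp0 hp1.le hdisj hsep hnum
  set E : Finset ℕ → Prop := fun X => IsB2g (↑(O ∪ X) : Set ℕ) g with hE
  have hZ : 0 < expect p Ω (ind E) := expect_ind_pos hp1 hp0 Ω (by simpa [hE] using hO)
  have hanti : Antitone (ind E) := antitone_ind (antitone_isB2g_union O g)
  have hsplit : expect p Ω (ind E) ≤
      expect p Ω (fun X => ∑ n ∈ I, ind (fun X => E X ∧ Disjoint X (W n)) X) +
      expect p Ω (fun X => ∑ r ∈ J, 2 ^ k * (ind E X * (1 / 2) ^ (X ∩ C r).card)) +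
      expect p Ω (fun X => B⁻¹ * ∑ x ∈ Ω, ind E X * ind (fun Y => {x} ⊆ Y) X) := by
    rw [← expect_add, ← expect_add]
    refine expect_mono hp0 hp1.le fun X hX => ?_
    have n1 : ∀ n ∈ I, 0 ≤ ind (fun X => E X ∧ Disjoint X (W n)) X := fun n _ => ind_nonneg _ _
    have n2 : ∀ r ∈ J, 0 ≤ 2 ^ k * (ind E X * (1 / 2) ^ (X ∩ C r).card) := fun r _ =>
      mul_nonneg (by positivity) (mul_nonneg (ind_nonneg _ _) (by positivity))
    have n3 : 0 ≤ B⁻¹ * ∑ x ∈ Ω, ind E X * ind (fun Y => {x} ⊆ Y) X :=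
      mul_nonneg (by positivity)
        (Finset.sum_nonneg fun x _ => mul_nonneg (ind_nonneg _ _) (ind_nonneg _ _))
    have m1 := Finset.sum_nonneg n1
    have m2 := Finset.sum_nonneg n2
    by_cases hEX : E X
    swap
    · rw [ind_of_not hEX] at *
      linarith
    by_cases h1 : ∀ n ∈ I, ∃ x ∈ X, x ∈ W n
    swap
    · push Not at h1
      obtain ⟨n, hn, hnX⟩ := h1
      have := Finset.single_le_sum n1 hn
      rw [ind_of ⟨hEX, Finset.disjoint_left.2 hnX⟩] at this
      linarith [ind_of hEX]
    by_cases h2 : ∀ r ∈ J, k < (X ∩ C r).card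
    swap
    · push Not at h2
      obtain ⟨r, hr, hrX⟩ := h2
      have := Finset.single_le_sum n2 hr
      have h3 : (1 : ℝ) ≤ 2 ^ k * (1 / 2) ^ (X ∩ C r).card := by
        have : ((1 : ℝ) / 2) ^ k ≤ (1 / 2) ^ (X ∩ C r).card :=
          pow_le_pow_of_le_one (by norm_num) (by norm_num) hrX
        calc (1 : ℝ) = 2 ^ k * (1 / 2) ^ k := by rw [← mul_pow]; norm_num
          _ ≤ _ := mul_le_mul_of_nonneg_left this (by positivity)
      have h4 : 2 ^ k * (ind E X * (1 / 2) ^ (X ∩ C r).card) = 2 ^ k * (1 / 2) ^ (X ∩ C r).card := by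
        rw [ind_of hEX, one_mul]
      rw [h4] at this
      linarith [ind_of hEX]
    have h3 := hcon X hX hEX h1 h2
    have h4 : ∑ x ∈ Ω, ind E X * ind (fun Y => {x} ⊆ Y) X ≥ X.card := by
      calc (X.card : ℝ) = ∑ x ∈ X, 1 := by simp
        _ ≤ ∑ x ∈ X, ind E X * ind (fun Y => {x} ⊆ Y) X := by
            refine Finset.sum_le_sum fun x hx => ?_
            rw [ind_of hEX, ind_of (Finset.singleton_subset_iff.2 hx), one_mul]
        _ ≤ _ := Finset.sum_le_sum_of_subset_of_nonneg hX fun x _ _ =>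
            mul_nonneg (ind_nonneg _ _) (ind_nonneg _ _)
    have h5 : 1 ≤ B⁻¹ * ∑ x ∈ Ω, ind E X * ind (fun Y => {x} ⊆ Y) X := by
      rw [inv_mul_eq_div, le_div_iff₀ hB0]
      linarith
    linarith [ind_of hEX]
  have b1 : expect p Ω (fun X => ∑ n ∈ I, ind (fun X => E X ∧ Disjoint X (W n)) X) ≤
      1 / 4 * expect p Ω (ind E) := by
    rw [expect_sum]
    refine (Finset.sum_le_sum fun n hn =>
      expect_miss_le hp0 hp1.le hH (W n) Ω (hW n hn) subset_rfl).trans ?_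
    rw [← Finset.sum_mul]
    exact mul_le_mul_of_nonneg_right hWsum hZ.le
  have b2 : expect p Ω (fun X => ∑ r ∈ J, 2 ^ k * (ind E X * (1 / 2) ^ (X ∩ C r).card)) ≤
      1 / 4 * expect p Ω (ind E) := by
    rw [expect_sum]
    refine le_trans ?_ (mul_le_mul_of_nonneg_right hCsum hZ.le)
    rw [Finset.sum_mul]
    refine Finset.sum_le_sum fun r hr => ?_
    rw [expect_const_mul, mul_assoc]
    exact mul_le_mul_of_nonneg_left (expect_half_pow_le hp0 hp1.le hH (hC r hr)) (by positivity)
  have b3 : expect p Ω (fun X => B⁻¹ * ∑ x ∈ Ω, ind E X * ind (fun Y => {x} ⊆ Y) X) ≤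
      1 / 4 * expect p Ω (ind E) := by
    rw [expect_const_mul, expect_sum, inv_mul_eq_div, div_le_iff₀ hB0]
    refine (Finset.sum_le_sum fun x _ => expect_mul_subset_le hp0 hp1.le Ω {x} (ind E)
      (ind_nonneg E) hanti).trans ?_
    simp only [Finset.card_singleton, pow_one, Finset.sum_const, nsmul_eq_mul]
    nlinarith [mul_le_mul_of_nonneg_right hB hZ.le]
  linarith

/-! ### Three residue classes cut out of a Sidon set modulo `3783` -/

/-- Three parts of a Sidon set modulo `3783`, indexed by `t` modulo `3`. -/
def residues (t : ℕ) : List ℕ :=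
  if t % 3 = 0 then
    [33, 363, 568, 633, 644, 1188, 1213, 1635, 1717, 1763, 1838, 1886, 2002, 2081, 2233, 2565,
      2744, 2787, 2807, 3201, 3304, 3464, 3511]
  else if t % 3 = 1 then
    [0, 1, 162, 661, 711, 960, 1379, 1648, 1744, 1779, 2122, 2254, 2494, 2550, 2620, 2642, 2946,
      3003, 3328, 3679]
  else
    [610, 989, 1249, 1313, 1789, 1971, 2008, 2120, 2180, 2410, 3084, 3093, 3290, 3358, 3504,
      3508, 3516, 3599, 3697]

/-- All residues in use. -/
def allResidues : List ℕ := residues 0 ++ residues 1 ++ residues 2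

/-- The bit mask of the sumset of a list and the set coded by `m`. -/
def shiftUnion (l : List ℕ) (m : ℕ) : ℕ := l.foldr (fun x acc => m <<< x ||| acc) 0

lemma testBit_shiftUnion (l : List ℕ) (m n : ℕ) :
    (shiftUnion l m).testBit n = true ↔ ∃ x ∈ l, x ≤ n ∧ m.testBit (n - x) = true := by
  induction l with
  | nil => simp [shiftUnion]
  | cons x l ih =>
    have : shiftUnion (x :: l) m = m <<< x ||| shiftUnion l m := rfl
    rw [this, Nat.testBit_or, Bool.or_eq_true, ih, Nat.testBit_shiftLeft]
    simp

/-- The bit mask of the sumset of two lists. -/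
def sumMask (l l' : List ℕ) : ℕ := shiftUnion l (shiftUnion l' 1)

lemma testBit_mask (l : List ℕ) (n : ℕ) : (shiftUnion l 1).testBit n = true ↔ n ∈ l := by
  rw [testBit_shiftUnion]
  constructor
  · rintro ⟨x, hx, hxn, h⟩
    have : n - x = 0 := Nat.testBit_one_eq_true_iff_self_eq_zero.1 h
    rwa [show n = x by omega]
  · exact fun h => ⟨n, h, le_rfl, by simp⟩

lemma testBit_sumMask (l l' : List ℕ) (n : ℕ) :
    (sumMask l l').testBit n = true ↔ ∃ x ∈ l, ∃ y ∈ l', x + y = n := by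
  simp only [sumMask, testBit_shiftUnion _ _ n, testBit_mask]
  constructor
  · rintro ⟨x, hx, hxn, h⟩
    exact ⟨x, hx, _, h, by omega⟩
  · rintro ⟨x, hx, y, hy, rfl⟩
    exact ⟨x, hx, by omega, by simpa using hy⟩

lemma residues_mod (t : ℕ) : residues (t % 3) = residues t := by
  simp [residues]

lemma residues_lt {t x : ℕ} (hx : x ∈ residues t) : x < 3783 := by
  have h : ∀ t < 3, ∀ x ∈ residues t, x < 3783 := by decide +kernel
  exact h (t % 3) (Nat.mod_lt _ (by norm_num)) x (by rwa [residues_mod])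

lemma residues_ne_nil (t : ℕ) : residues t ≠ [] := by
  unfold residues; split_ifs <;> simp

lemma mem_allResidues {t x : ℕ} (hx : x ∈ residues t) : x ∈ allResidues := by
  rw [← residues_mod] at hx
  have := Nat.mod_lt t (show 3 > 0 by norm_num)
  simp only [allResidues, List.mem_append]
  generalize t % 3 = a at *
  interval_cases a <;> tauto

lemma mem_other {t u x : ℕ} (hx : x ∈ residues u) (h : u % 3 ≠ t % 3) :
    x ∈ residues (t % 3 + 1) ++ residues (t % 3 + 2) := by
  rw [List.mem_append, ← residues_mod (t % 3 + 1), ← residues_mod (t % 3 + 2)]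
  rw [← residues_mod] at hx
  rcases (by omega : u % 3 = (t % 3 + 1) % 3 ∨ u % 3 = (t % 3 + 2) % 3) with h | h
  · rw [h] at hx; exact Or.inl hx
  · rw [h] at hx; exact Or.inr hx

lemma land_ne_zero {a b n : ℕ} (ha : a.testBit n = true) (hb : b.testBit n = true) :
    a &&& b ≠ 0 := by
  intro h
  have := Nat.testBit_and a b n
  rw [h, ha, hb] at this
  simp at this

lemma residues_sep {t s u v x z z₁ z₂ : ℕ} (hx : x ∈ residues t) (hz : z ∈ residues s)
    (hz₁ : z₁ ∈ residues u) (hz₂ : z₂ ∈ residues v) (h : x + z ≡ z₁ + z₂ [MOD 3783]) :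
    u % 3 = t % 3 ∨ v % 3 = t % 3 := by
  by_contra! hcon
  have key : ∀ a < 3,
      sumMask (residues a) allResidues &&&
        sumMask (residues (a + 1) ++ residues (a + 2)) (residues (a + 1) ++ residues (a + 2)) = 0 ∧
      sumMask (residues a) allResidues &&&
        sumMask (residues (a + 1) ++ residues (a + 2)) (residues (a + 1) ++ residues (a + 2)) <<<
          3783 = 0 ∧
      sumMask (residues a) allResidues <<< 3783 &&&
        sumMask (residues (a + 1) ++ residues (a + 2)) (residues (a + 1) ++ residues (a + 2)) =
          0 := by
    decide +kernel
  obtain ⟨k1, k2, k3⟩ := key (t % 3) (Nat.mod_lt _ (by norm_num))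
  have b1 : (sumMask (residues (t % 3)) allResidues).testBit (x + z) = true :=
    (testBit_sumMask _ _ _).2 ⟨x, by rwa [residues_mod], z, mem_allResidues hz, rfl⟩
  have b2 := (testBit_sumMask _ _ _).2
    ⟨z₁, mem_other hz₁ hcon.1, z₂, mem_other hz₂ hcon.2, rfl⟩
  have l1 := residues_lt hx
  have l2 := residues_lt hz
  have l3 := residues_lt hz₁
  have l4 := residues_lt hz₂
  rw [Nat.ModEq] at h
  rcases (by omega : x + z = z₁ + z₂ ∨ x + z = z₁ + z₂ + 3783 ∨ x + z + 3783 = z₁ + z₂)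
    with e | e | e
  · rw [e] at b1
    exact land_ne_zero b1 b2 k1
  · refine land_ne_zero b1 (n := x + z) ?_ k2
    rw [e, Nat.testBit_shiftLeft]
    simpa using b2
  · refine land_ne_zero (n := z₁ + z₂) ?_ b2 k3
    rw [← e, Nat.testBit_shiftLeft]
    simpa using b1

lemma residues_cover {a b : ℕ} (hab : a % 3 ≠ b % 3) (n : ℕ) :
    ∃ c < 3, ∃ x ∈ residues a, ∃ y ∈ residues b, ∃ s ∈ residues c,
      x + y + s ≡ n [MOD 3783] := by
  have key : ∀ a < 3, ∀ b < 3, a ≠ b →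
      (shiftUnion (residues a) (sumMask (residues b) allResidues) |||
        shiftUnion (residues a) (sumMask (residues b) allResidues) >>> 3783 |||
        shiftUnion (residues a) (sumMask (residues b) allResidues) >>> (2 * 3783)) % 2 ^ 3783 =
          2 ^ 3783 - 1 := by
    decide +kernel
  have h := key (a % 3) (Nat.mod_lt _ (by norm_num)) (b % 3) (Nat.mod_lt _ (by norm_num)) hab
  have hn : n % 3783 < 3783 := Nat.mod_lt _ (by norm_num)
  have h1 := congrArg (fun m => m.testBit (n % 3783)) h
  simp only [Nat.testBit_mod_two_pow, Nat.testBit_two_pow_sub_one, hn, decide_true,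
    Bool.true_and, Nat.testBit_or, Nat.testBit_shiftRight, Bool.or_eq_true] at h1
  have hT : ∀ k, (shiftUnion (residues (a % 3)) (sumMask (residues (b % 3)) allResidues)).testBit
      k = true → k % 3783 = n % 3783 → ∃ c < 3, ∃ x ∈ residues a, ∃ y ∈ residues b,
        ∃ s ∈ residues c, x + y + s ≡ n [MOD 3783] := by
    intro k hk hkn
    obtain ⟨x, hx, hxk, hk⟩ := (testBit_shiftUnion _ _ _).1 hk
    obtain ⟨y, hy, s, hs, hk⟩ := (testBit_sumMask _ _ _).1 hk
    rw [residues_mod] at hx hy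
    have : ∃ c < 3, s ∈ residues c := by
      simp only [allResidues, List.mem_append] at hs
      rcases hs with (h | h) | h
      exacts [⟨0, by norm_num, h⟩, ⟨1, by norm_num, h⟩, ⟨2, by norm_num, h⟩]
    obtain ⟨c, hc, hsc⟩ := this
    refine ⟨c, hc, x, hx, y, hy, s, hsc, ?_⟩
    rw [show x + y + s = k by omega]
    exact hkn
  rcases h1 with (h1 | h1) | h1
  · exact hT _ h1 (by omega)
  · exact hT _ h1 (by omega)
  · exact hT _ h1 (by omega)

/-! ### Growth functions -/

/-- The exponent `g / (2 g + 1)` of the counting function. -/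
def gam (g : ℕ) : ℝ := (g : ℝ) / (2 * (g : ℝ) + 1)

/-- The order of magnitude of the number of elements of the sequence near `2 ^ t`. -/
def growth (g t : ℕ) : ℝ := ((2 : ℝ) ^ t) ^ gam g

/-- The selection probability near `2 ^ t`. -/
def prob (g t : ℕ) : ℝ := growth g t / (68 * 2 ^ t)

/-- The order of magnitude of the small summand used in representing integers near `2 ^ t`. -/
def smallBound (g : ℕ) (K : ℝ) (t : ℕ) : ℝ :=
  (K * t) ^ (2 + (1 : ℝ) / (g : ℝ)) * ((2 : ℝ) ^ t) ^ ((1 : ℝ) / (g : ℝ))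

lemma gam_nonneg (g : ℕ) : 0 ≤ gam g := by unfold gam; positivity

lemma gam_le_one (g : ℕ) : gam g ≤ 1 := by
  unfold gam
  rw [div_le_one (by positivity)]
  have : (0 : ℝ) ≤ g := by positivity
  linarith

lemma two_fifths_le_gam {g : ℕ} (hg : 2 ≤ g) : 2 / 5 ≤ gam g := by
  unfold gam
  have : (2 : ℝ) ≤ g := by exact_mod_cast hg
  rw [div_le_div_iff₀ (by norm_num) (by positivity)]
  linarith

lemma growth_pos (g t : ℕ) : 0 < growth g t := by unfold growth; positivity

lemma growth_succ (g t : ℕ) : growth g (t + 1) = 2 ^ gam g * growth g t := by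
  rw [growth, growth, pow_succ', Real.mul_rpow (by norm_num) (by positivity)]

lemma growth_succ_ge {g : ℕ} (hg : 2 ≤ g) (t : ℕ) : 5 / 4 * growth g t ≤ growth g (t + 1) := by
  rw [growth_succ]
  refine mul_le_mul_of_nonneg_right ?_ (growth_pos g t).le
  calc (5 / 4 : ℝ) = ((5 / 4 : ℝ) ^ (5 / 2 : ℝ)) ^ (2 / 5 : ℝ) := by
        rw [← Real.rpow_mul (by norm_num)]; norm_num
    _ ≤ 2 ^ (2 / 5 : ℝ) := by
        refine Real.rpow_le_rpow (by positivity) ?_ (by norm_num)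
        refine le_of_sq_le_sq ?_ (by norm_num)
        rw [← Real.rpow_natCast, ← Real.rpow_mul (by norm_num)]
        norm_num
    _ ≤ 2 ^ gam g := Real.rpow_le_rpow_of_exponent_le (by norm_num) (two_fifths_le_gam hg)

lemma growth_add_le (g t j : ℕ) : growth g (t + j) ≤ 2 ^ j * growth g t := by
  rw [growth, growth, pow_add, Real.mul_rpow (by positivity) (by positivity), mul_comm]
  refine mul_le_mul_of_nonneg_right ?_ (by positivity)
  have h : (1 : ℝ) ≤ 2 ^ j := one_le_pow₀ (by norm_num)
  simpa using Real.rpow_le_rpow_of_exponent_le h (gam_le_one g)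

lemma growth_mono (g : ℕ) {s t : ℕ} (h : s ≤ t) : growth g s ≤ growth g t :=
  Real.rpow_le_rpow (by positivity) (pow_le_pow_right₀ (by norm_num) h) (gam_nonneg g)

lemma growth_le_two_pow (g t : ℕ) : growth g t ≤ 2 ^ t := by
  simpa [growth] using growth_add_le g 0 t

lemma growth_pow (g t : ℕ) : growth g t ^ (2 * g + 1) = ((2 : ℝ) ^ t) ^ g := by
  have h : gam g * ((2 * g + 1 : ℕ) : ℝ) = (g : ℕ) := by
    unfold gam
    push_cast
    field_simp
  rw [growth, ← Real.rpow_natCast, ← Real.rpow_mul (by positivity), h, Real.rpow_natCast]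

lemma prob_pos (g t : ℕ) : 0 < prob g t := by
  have := growth_pos g t
  unfold prob; positivity

lemma prob_lt_one (g t : ℕ) : prob g t < 1 := by
  unfold prob
  rw [div_lt_one (by positivity)]
  have := growth_le_two_pow g t
  have : (0 : ℝ) < 2 ^ t := by positivity
  linarith

lemma prob_mul_two_pow (g t : ℕ) : prob g t * 2 ^ t = growth g t / 68 := by
  unfold prob
  field_simp

lemma prob_pow_mul_le (g t : ℕ) {h : ℝ} (hh0 : 0 ≤ h)
    (hh : h ≤ 34 * (growth g t / 68)) :
    prob g t ^ g * h ^ (g + 1) ≤ 1 / 2 := by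
  have hp := (prob_pos g t).le
  have h1 : h ≤ growth g t / 2 := by linarith
  have hU := growth_pos g t
  have h2 : prob g t * (68 * 2 ^ t) = growth g t := by
    unfold prob; field_simp
  have h3 : (prob g t * 2 ^ t) ^ g * (growth g t) ^ (g + 1) ≤ ((2 : ℝ) ^ t) ^ g := by
    rw [← growth_pow, show 2 * g + 1 = g + (g + 1) by ring, pow_add _ g (g + 1)]
    refine mul_le_mul_of_nonneg_right (pow_le_pow_left₀ ?_ ?_ g) (pow_nonneg hU.le _)
    · positivity
    · rw [prob_mul_two_pow]
      linarith
  have h4 : prob g t ^ g * growth g t ^ (g + 1) ≤ 1 := by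
    rw [mul_pow] at h3
    have : (0 : ℝ) < (2 ^ t) ^ g := by positivity
    nlinarith
  calc prob g t ^ g * h ^ (g + 1) ≤ prob g t ^ g * (growth g t / 2) ^ (g + 1) := by gcongr
    _ = (prob g t ^ g * growth g t ^ (g + 1)) * (1 / 2) ^ (g + 1) := by
        rw [div_pow, one_div, inv_pow]; ring
    _ ≤ 1 * (1 / 2) ^ 1 := by
        exact mul_le_mul h4 (pow_le_pow_of_le_one (by norm_num) (by norm_num) (by omega))
          (by positivity) (by norm_num)
    _ = 1 / 2 := by norm_num

lemma smallBound_rpow {g : ℕ} (hg : 2 ≤ g) {K : ℝ} (hK : 0 ≤ K) (t : ℕ) :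
    smallBound g K t ^ gam g * growth g t ^ 2 = K * t * 2 ^ t := by
  have hg0 : (g : ℝ) ≠ 0 := by positivity
  have h2 : (0 : ℝ) < 2 ^ t := by positivity
  have e1 : (2 + (1 : ℝ) / g) * gam g = 1 := by
    unfold gam; field_simp
  have e2 : (1 : ℝ) / g * gam g + gam g * (2 : ℕ) = 1 := by
    unfold gam; push_cast; field_simp; ring
  rw [smallBound, Real.mul_rpow (by positivity) (by positivity), ← Real.rpow_mul (by positivity),
    e1, Real.rpow_one, ← Real.rpow_mul h2.le, growth, ← Real.rpow_natCast _ 2,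
    ← Real.rpow_mul h2.le, mul_assoc, ← Real.rpow_add h2, e2, Real.rpow_one]

lemma le_smallBound {g : ℕ} {K : ℝ} (hK : 1 ≤ K) {t : ℕ} (ht : 1 ≤ t) :
    (t : ℝ) ≤ smallBound g K t := by
  have ht' : (1 : ℝ) ≤ t := by exact_mod_cast ht
  have h1 : 1 ≤ K * t := by nlinarith
  have h2 : K * t ≤ (K * t) ^ (2 + (1 : ℝ) / (g : ℝ)) := by
    refine (Real.rpow_one _).symm.le.trans (Real.rpow_le_rpow_of_exponent_le h1 ?_)
    have : (0 : ℝ) ≤ 1 / g := by positivity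
    linarith
  have h3 : (1 : ℝ) ≤ ((2 : ℝ) ^ t) ^ ((1 : ℝ) / (g : ℝ)) :=
    Real.one_le_rpow (one_le_pow₀ (by norm_num)) (by positivity)
  unfold smallBound
  nlinarith

open Filter Topology in
lemma eventually_smallBound_le {g : ℕ} (hg : 2 ≤ g) {K : ℝ} (hK : 1 ≤ K) :
    ∀ᶠ t : ℕ in atTop, 4096 * smallBound g K t ≤ 2 ^ t := by
  have hs : (1 : ℝ) < √2 := by
    rw [Real.lt_sqrt (by norm_num)]; norm_num
  have hlim := tendsto_pow_const_div_const_pow_of_one_lt 3 hs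
  have hε : (0 : ℝ) < 1 / (4096 * K ^ 3) := by positivity
  filter_upwards [hlim.eventually (gt_mem_nhds hε), eventually_ge_atTop 1] with t ht ht1
  have ht' : (1 : ℝ) ≤ t := by exact_mod_cast ht1
  have h1 : 1 ≤ K * t := by nlinarith
  have hg2 : (2 : ℝ) ≤ g := by exact_mod_cast hg
  have hinv : (1 : ℝ) / g ≤ 1 / 2 := one_div_le_one_div_of_le (by norm_num) hg2
  have b1 : (K * t) ^ (2 + (1 : ℝ) / (g : ℝ)) ≤ (K * t) ^ 3 := by
    rw [← Real.rpow_natCast]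
    exact Real.rpow_le_rpow_of_exponent_le h1 (by push_cast; linarith)
  have hsq : (0 : ℝ) < √2 ^ t := by positivity
  have e : (√2 ^ t) * (√2 ^ t) = (2 : ℝ) ^ t := by
    rw [← mul_pow, Real.mul_self_sqrt (by norm_num)]
  have b2 : ((2 : ℝ) ^ t) ^ ((1 : ℝ) / (g : ℝ)) ≤ √2 ^ t := by
    refine (Real.rpow_le_rpow_of_exponent_le (one_le_pow₀ (by norm_num)) hinv).trans_eq ?_
    rw [← Real.sqrt_eq_rpow, ← e, Real.sqrt_mul_self hsq.le]
  rw [div_lt_div_iff₀ hsq (by positivity)] at ht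
  calc 4096 * smallBound g K t ≤ 4096 * ((K * t) ^ 3 * √2 ^ t) := by
        unfold smallBound; gcongr
    _ = (t ^ 3 * (4096 * K ^ 3)) * √2 ^ t := by ring
    _ ≤ (1 * √2 ^ t) * √2 ^ t := by gcongr
    _ = 2 ^ t := by rw [one_mul, e]

open Filter in
lemma eventually_le_growth {g : ℕ} (hg : 2 ≤ g) (b : ℝ) : ∀ᶠ t : ℕ in atTop, b ≤ growth g t := by
  have h : ∀ t, (5 / 4 : ℝ) ^ t ≤ growth g t := by
    intro t
    induction t with
    | zero => simp [growth]
    | succ t ih =>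
      have := growth_succ_ge hg t
      rw [pow_succ]
      linarith
  filter_upwards [(tendsto_pow_atTop_atTop_of_one_lt (by norm_num : (1 : ℝ) < 5 / 4)).eventually
    (eventually_ge_atTop b)] with t ht
  exact ht.trans (h t)

/-! ### Dyadic levels -/

/-- The candidates for elements of the sequence of size about `2 ^ t`. -/
def level (t : ℕ) : Finset ℕ :=
  (Finset.Ico (2 ^ t) (2 ^ (t + 1))).filter fun x => 16 * x < 25 * 2 ^ t ∧ x % 3783 ∈ residues t

/-- The candidates of size about `2 ^ t` in the residue class of `r`. -/
def levelClass (t r : ℕ) : Finset ℕ := (level t).filter fun x => x % 3783 = r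

lemma mem_level {t x : ℕ} :
    x ∈ level t ↔ 2 ^ t ≤ x ∧ 16 * x < 25 * 2 ^ t ∧ x % 3783 ∈ residues t := by
  have : 2 ^ (t + 1) = 2 * 2 ^ t := pow_succ' 2 t
  simp only [level, Finset.mem_filter, Finset.mem_Ico]
  constructor
  · rintro ⟨⟨h1, -⟩, h2⟩
    exact ⟨h1, h2⟩
  · rintro ⟨h1, h2⟩
    exact ⟨⟨h1, by omega⟩, h2⟩

lemma mem_levelClass {t r x : ℕ} : x ∈ levelClass t r ↔ x ∈ level t ∧ x % 3783 = r :=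
  Finset.mem_filter

lemma card_level_le (t : ℕ) : (level t).card ≤ 2 ^ t := by
  refine (Finset.card_filter_le _ _).trans ?_
  rw [Nat.card_Ico, pow_succ']
  omega

lemma le_card_levelClass {t r : ℕ} (hr : r ∈ residues t) (ht : 32 * 3783 ≤ 2 ^ t) :
    (2 : ℝ) ^ t / (2 * 3783) ≤ (levelClass t r).card := by
  have hlt := residues_lt hr
  have hcard : 2 ^ t / (2 * 3783) + 1 ≤ (levelClass t r).card := by
    rw [← Finset.card_range (2 ^ t / (2 * 3783) + 1)]
    refine Finset.card_le_card_of_injOn (fun i => r + 3783 * (2 ^ t / 3783 + 1 + i))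
      (fun i hi => ?_) (fun i _ j _ h => ?_)
    · have hi' := Finset.mem_range.1 hi
      have hm : (r + 3783 * (2 ^ t / 3783 + 1 + i)) % 3783 = r := by omega
      refine mem_levelClass.2 ⟨mem_level.2 ⟨?_, ?_, ?_⟩, hm⟩
      · change 2 ^ t ≤ r + 3783 * (2 ^ t / 3783 + 1 + i)
        omega
      · change 16 * (r + 3783 * (2 ^ t / 3783 + 1 + i)) < 25 * 2 ^ t
        omega
      · rw [hm]; exact hr
    · simp only at h
      omega
  have h2 : 2 ^ t ≤ (levelClass t r).card * (2 * 3783) := by omega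
  rw [div_le_iff₀ (by norm_num)]
  exact_mod_cast h2

lemma length_residues_le (t : ℕ) : (residues t).length ≤ 23 := by
  unfold residues; split_ifs <;> simp

/-- The properties of the part of the sequence constructed before level `t`. -/
structure Stage (g t₀ t₁ : ℕ) (K : ℝ) (t : ℕ) (O : Finset ℕ) : Prop where
  sub : ∀ x ∈ O, ∃ s, t₀ ≤ s ∧ s < t ∧ x ∈ level s
  isB2g : IsB2g (O : Set ℕ) g
  card_le : (O.card : ℝ) ≤ 16 * (growth g t / 68)
  le_card : ∀ s, t₀ ≤ s → s < t → ∀ r ∈ residues s,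
    growth g s / 4115904 ≤ ((O ∩ levelClass s r).card : ℝ)
  cover : ∀ s, t₁ ≤ s → s < t → ∀ n, 33 * 2 ^ s ≤ 32 * n → 32 * n < 33 * 2 ^ (s + 1) →
    ∃ a₁ ∈ O, ∃ a₂ ∈ O, ∃ a₃ ∈ O, n = a₁ + a₂ + a₃ ∧ (a₃ : ℝ) ≤ 16 * smallBound g K s

lemma isB2g_empty (g : ℕ) : IsB2g ((∅ : Finset ℕ) : Set ℕ) g :=
  isB2g_coe.2 fun m => by simp [reps]

lemma stage_empty {g t₀ t₁ : ℕ} {K : ℝ} (h : t₀ ≤ t₁) : Stage g t₀ t₁ K t₀ ∅ where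
  sub := by simp
  isB2g := isB2g_empty g
  card_le := by
    have := growth_pos g t₀
    simp only [Finset.card_empty, Nat.cast_zero]
    positivity
  le_card := fun s h1 h2 => by omega
  cover := fun s h1 h2 => by omega

namespace Stage

variable {g t₀ t₁ t : ℕ} {K : ℝ} {O : Finset ℕ}

lemma lt (h : Stage g t₀ t₁ K t O) {x : ℕ} (hx : x ∈ O) : 32 * x < 25 * 2 ^ t := by
  obtain ⟨s, -, hs, hxs⟩ := h.sub x hx
  have h1 := (mem_level.1 hxs).2.1
  have h2 : 2 ^ (s + 1) ≤ 2 ^ t := Nat.pow_le_pow_right (by norm_num) hs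
  rw [pow_succ] at h2
  omega

lemma disjoint (h : Stage g t₀ t₁ K t O) : Disjoint O (level t) := by
  rw [Finset.disjoint_left]
  intro x hx hxt
  have h1 := h.lt hx
  have h2 := (mem_level.1 hxt).1
  omega

lemma sep (h : Stage g t₀ t₁ K t O) : ∀ x ∈ level t, ∀ z ∈ O ∪ level t, ∀ z₁ ∈ O, ∀ z₂ ∈ O,
    x + z ≠ z₁ + z₂ := by
  intro x hx z hz z₁ hz₁ z₂ hz₂ heq
  obtain ⟨hx1, -, hx2⟩ := mem_level.1 hx
  obtain ⟨s, hzs⟩ : ∃ s, z ∈ level s := by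
    rcases Finset.mem_union.1 hz with hz | hz
    · obtain ⟨s, -, -, hs⟩ := h.sub z hz
      exact ⟨s, hs⟩
    · exact ⟨t, hz⟩
  obtain ⟨u, -, hu, hz₁u⟩ := h.sub z₁ hz₁
  obtain ⟨v, -, hv, hz₂v⟩ := h.sub z₂ hz₂
  have l1 := h.lt hz₁
  have l2 := h.lt hz₂
  have hz3 := (mem_level.1 hzs).2.2
  obtain ⟨-, a1, a2⟩ := mem_level.1 hz₁u
  obtain ⟨-, b1, b2⟩ := mem_level.1 hz₂v
  have hmod : x % 3783 + z % 3783 ≡ z₁ % 3783 + z₂ % 3783 [MOD 3783] := by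
    rw [Nat.ModEq]
    omega
  have hpow : ∀ w, w < t → w % 3 = t % 3 → 8 * 2 ^ w ≤ 2 ^ t := by
    intro w hw hwt
    have : 2 ^ (w + 3) ≤ 2 ^ t := Nat.pow_le_pow_right (by norm_num) (by omega)
    rw [pow_add] at this
    omega
  rcases residues_sep hx2 hz3 a2 b2 hmod with e | e
  · have := hpow u hu e
    omega
  · have := hpow v hv e
    omega

end Stage

lemma one_sub_pow_le_exp {x : ℝ} (hx : x ≤ 1) (n : ℕ) : (1 - x) ^ n ≤ Real.exp (-(x * n)) := by
  have h : 1 - x ≤ Real.exp (-x) := by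
    have := Real.add_one_le_exp (-x)
    linarith
  refine (pow_le_pow_left₀ (by linarith) h n).trans_eq ?_
  rw [← Real.exp_nat_mul]
  congr 1
  ring

lemma exp_neg_three_mul_le (t : ℕ) : Real.exp (-(3 * t)) ≤ 1 / 8 ^ t := by
  have h2 : (2 : ℝ) ≤ Real.exp 1 := by
    have := Real.add_one_le_exp (1 : ℝ)
    linarith
  have h : (8 : ℝ) ^ t ≤ Real.exp (3 * t) := by
    calc (8 : ℝ) ^ t = (2 ^ 3) ^ t := by norm_num
      _ ≤ (Real.exp 1 ^ 3) ^ t := by gcongr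
      _ = Real.exp (3 * t) := by
        rw [← Real.exp_nat_mul, ← Real.exp_nat_mul]
        congr 1
        push_cast
        ring
  rw [Real.exp_neg, ← one_div]
  exact one_div_le_one_div_of_le (by positivity) h

lemma twenty_three_mul_exp_le {y : ℝ} (hy : 6 ≤ y) : 23 * Real.exp (-y) ≤ 1 / 4 := by
  have h2 : (2.7 : ℝ) ≤ Real.exp 1 := by
    have := Real.exp_one_gt_d9
    linarith
  have h : (92 : ℝ) ≤ Real.exp y := by
    calc (92 : ℝ) ≤ 2.7 ^ 6 := by norm_num
      _ ≤ Real.exp 1 ^ 6 := by gcongr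
      _ = Real.exp 6 := by rw [← Real.exp_nat_mul]; norm_num
      _ ≤ Real.exp y := Real.exp_le_exp.2 hy
  rw [Real.exp_neg, ← div_eq_mul_inv, div_le_div_iff₀ (by positivity) (by norm_num)]
  linarith

/-! ### The step from one level to the next -/

namespace Stage

variable {g t₀ t₁ t : ℕ} {K : ℝ} {O : Finset ℕ}

/-- If the two old summands are taken from fixed residue classes of fixed levels, then the
possible third summands form a large set. -/
lemma card_image_sub (h : Stage g t₀ t₁ K t O) {σ b ρ₁ ρ₂ n : ℕ} (hσ : σ < b)
    (hn : ∀ s ∈ levelClass σ ρ₁, ∀ y ∈ levelClass b ρ₂, s + y ≤ n) :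
    (O ∩ levelClass σ ρ₁).card * (O ∩ levelClass b ρ₂).card ≤
      g * (((O ∩ levelClass σ ρ₁) ×ˢ (O ∩ levelClass b ρ₂)).image
        fun q => n - q.1 - q.2).card := by
  rw [← Finset.card_product]
  refine Finset.card_le_mul_card_image _ _ fun w hw => ?_
  refine le_trans ?_ (isB2g_coe.1 h.isB2g (n - w))
  refine Finset.card_le_card fun q hq => ?_
  obtain ⟨hq1, hq2⟩ := Finset.mem_filter.1 hq
  obtain ⟨h1, h2⟩ := Finset.mem_product.1 hq1
  obtain ⟨h3, h4⟩ := Finset.mem_inter.1 h1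
  obtain ⟨h5, h6⟩ := Finset.mem_inter.1 h2
  have h7 := hn _ h4 _ h6
  have h8 := (mem_level.1 (mem_levelClass.1 h4).1).2.1
  have h9 := (mem_level.1 (mem_levelClass.1 h6).1).1
  have h10 : 2 ^ (σ + 1) ≤ 2 ^ b := Nat.pow_le_pow_right (by norm_num) hσ
  rw [pow_succ] at h10
  exact mem_reps.2 ⟨h3, h5, by omega, by omega⟩

lemma exists_shift {t n : ℕ} (ht : 7 ≤ t) (h1 : 33 * 2 ^ t ≤ 32 * n)
    (h2 : 32 * n < 33 * 2 ^ (t + 1)) :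
    ∃ b, b < t ∧ t ≤ b + 7 ∧ t % 3 ≠ b % 3 ∧ ∀ y s, 2 ^ b ≤ y → 16 * y < 25 * 2 ^ b →
      256 * s < 2 ^ t → 2 ^ t + s + y ≤ n ∧ 16 * n < 25 * 2 ^ t + 16 * s + 16 * y := by
  obtain ⟨u, rfl⟩ := Nat.exists_eq_add_of_le' ht
  have e0 : 2 ^ (u + 7) = 128 * 2 ^ u := by rw [pow_add]; ring
  have e1 : 2 ^ (u + 7 + 1) = 256 * 2 ^ u := by rw [pow_add, pow_add]; ring
  have e2 : 2 ^ (u + 6) = 64 * 2 ^ u := by rw [pow_add]; ring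
  have e3 : 2 ^ (u + 5) = 32 * 2 ^ u := by rw [pow_add]; ring
  rw [e0] at h1
  rw [e1] at h2
  by_cases c1 : 2 * n < 3 * 2 ^ (u + 7)
  · refine ⟨u, by omega, by omega, by omega, fun y s hy hy' hs => ?_⟩
    rw [e0] at *
    constructor <;> omega
  by_cases c2 : 16 * n < 29 * 2 ^ (u + 7)
  · refine ⟨u + 5, by omega, by omega, by omega, fun y s hy hy' hs => ?_⟩
    rw [e0] at *
    rw [e3] at *
    constructor <;> omega
  · refine ⟨u + 6, by omega, by omega, by omega, fun y s hy hy' hs => ?_⟩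
    rw [e0] at *
    rw [e2] at *
    constructor <;> omega

/-- Many elements of level `t` complete the representation of `n`. -/
lemma exists_completions (h : Stage g t₀ t₁ K t O) (hg : 2 ≤ g)
    (hK : 68 * 768 * 4115904 ^ 2 * g ≤ K) (ht : t₀ + 7 ≤ t) (hX0 : 2 ^ t₀ ≤ smallBound g K t)
    (hX1 : 4096 * smallBound g K t ≤ 2 ^ t) {n : ℕ}
    (h1 : 33 * 2 ^ t ≤ 32 * n) (h2 : 32 * n < 33 * 2 ^ (t + 1)) :
    ∃ W ⊆ level t, (∀ w ∈ W, ∃ y ∈ O, ∃ s ∈ O, n = w + y + s ∧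
      (s : ℝ) ≤ 16 * smallBound g K t) ∧ 6 * (t : ℝ) ≤ prob g t * W.card := by
  have hK0 : 0 ≤ K := le_trans (by positivity) hK
  obtain ⟨b, hbt, htb, hmod, hrange⟩ := exists_shift (by omega) h1 h2
  obtain ⟨c, hc, ρ, hρ, ρ₂, hρ₂, ρ₁, hρ₁, hsum⟩ := residues_cover hmod n
  obtain ⟨a, ha1, ha2⟩ := exists_nat_pow_near ((one_le_pow₀ one_le_two).trans hX0) one_lt_two
  obtain ⟨σ, hσ1, hσ2, hσc⟩ : ∃ σ, a + 1 ≤ σ ∧ σ ≤ a + 3 ∧ σ % 3 = c := by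
    rcases (by omega : (a + 1) % 3 = c ∨ (a + 2) % 3 = c ∨ (a + 3) % 3 = c) with e | e | e
    exacts [⟨a + 1, by omega, by omega, e⟩, ⟨a + 2, by omega, by omega, e⟩,
      ⟨a + 3, by omega, by omega, e⟩]
  have hσX : (2 : ℝ) ^ (σ + 1) ≤ 16 * smallBound g K t := by
    calc (2 : ℝ) ^ (σ + 1) ≤ 2 ^ (a + 4) := pow_le_pow_right₀ one_le_two (by omega)
      _ = 16 * 2 ^ a := by rw [pow_add]; ring
      _ ≤ _ := by linarith
  have hσsize : 256 * 2 ^ (σ + 1) ≤ 2 ^ t := by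
    have : (256 : ℝ) * 2 ^ (σ + 1) ≤ 2 ^ t := by linarith
    exact_mod_cast this
  have hσt₀ : t₀ ≤ σ := by
    have := (pow_lt_pow_iff_right₀ (one_lt_two (α := ℝ))).1 (hX0.trans_lt ha2)
    omega
  have hσb : σ < b := by
    have : 2 ^ (σ + 9) ≤ 2 ^ t := by
      rw [show σ + 9 = 8 + (σ + 1) by ring, pow_add]
      exact hσsize
    have := (Nat.pow_le_pow_iff_right (by norm_num)).1 this
    omega
  have hρ₁' : ρ₁ ∈ residues σ := by rwa [← residues_mod, hσc]
  set S := O ∩ levelClass σ ρ₁ with hS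
  set Y := O ∩ levelClass b ρ₂ with hY
  have hlev : ∀ s ∈ levelClass σ ρ₁, 256 * s < 2 ^ t ∧ s < 2 ^ (σ + 1) := by
    intro s hs
    have h3 := (mem_level.1 (mem_levelClass.1 hs).1).2.1
    rw [pow_succ] at hσsize ⊢
    constructor <;> omega
  have hsy : ∀ s ∈ levelClass σ ρ₁, ∀ y ∈ levelClass b ρ₂,
      2 ^ t + s + y ≤ n ∧ 16 * n < 25 * 2 ^ t + 16 * s + 16 * y := by
    intro s hs y hy
    have h4 := mem_level.1 (mem_levelClass.1 hy).1
    exact hrange y s h4.1 h4.2.1 (hlev s hs).1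
  have hcard := h.card_image_sub (n := n) hσb fun s hs y hy => by
    have := (hsy s hs y hy).1
    omega
  rw [← hS, ← hY] at hcard
  refine ⟨(S ×ˢ Y).image fun q => n - q.1 - q.2, ?_, ?_, ?_⟩
  · intro w hw
    obtain ⟨⟨s, y⟩, hq, rfl⟩ := Finset.mem_image.1 hw
    obtain ⟨hq1, hq2⟩ := Finset.mem_product.1 hq
    have hs := (Finset.mem_inter.1 hq1).2
    have hy := (Finset.mem_inter.1 hq2).2
    obtain ⟨r1, r2⟩ := hsy s hs y hy
    have m1 := (mem_levelClass.1 hs).2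
    have m2 := (mem_levelClass.1 hy).2
    have hw : n - s - y + y + s = n := by omega
    have m3 : (n - s - y) % 3783 = ρ := by
      have := residues_lt hρ
      rw [Nat.ModEq] at hsum
      simp only at m1 m2
      omega
    refine mem_level.2 ⟨?_, ?_, by simpa [m3] using hρ⟩
    · change 2 ^ t ≤ n - s - y
      omega
    · change 16 * (n - s - y) < _
      omega
  · intro w hw
    obtain ⟨⟨s, y⟩, hq, rfl⟩ := Finset.mem_image.1 hw
    obtain ⟨hq1, hq2⟩ := Finset.mem_product.1 hq
    obtain ⟨hsO, hs⟩ := Finset.mem_inter.1 hq1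
    obtain ⟨hyO, hy⟩ := Finset.mem_inter.1 hq2
    obtain ⟨r1, r2⟩ := hsy s hs y hy
    refine ⟨y, hyO, s, hsO, ?_, ?_⟩
    · change n = n - s - y + y + s
      omega
    · have : (s : ℝ) ≤ 2 ^ (σ + 1) := by exact_mod_cast (hlev s hs).2.le
      exact this.trans hσX
  · set N := ((S ×ˢ Y).image fun q => n - q.1 - q.2).card with hN
    have hg0 : (0 : ℝ) < g := by positivity
    have hScard := h.le_card σ hσt₀ (by omega) ρ₁ hρ₁'
    have hYcard := h.le_card b (by omega) hbt ρ₂ hρ₂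
    have hcardR : (S.card : ℝ) * Y.card ≤ g * N := by exact_mod_cast hcard
    have hU := growth_pos g t
    have hUσ := growth_pos g σ
    have hUb := growth_pos g b
    have hXσ : smallBound g K t ^ gam g ≤ growth g σ := by
      refine Real.rpow_le_rpow (by unfold smallBound; positivity) ?_ (gam_nonneg g)
      exact ha2.le.trans (pow_le_pow_right₀ one_le_two hσ1)
    have hbU : growth g t ≤ 128 * growth g b := by
      calc growth g t ≤ growth g (b + 7) := growth_mono g htb
        _ ≤ 2 ^ 7 * growth g b := growth_add_le g b 7
        _ = 128 * growth g b := by norm_num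
    have e1 := smallBound_rpow hg hK0 t
    have hX : 0 ≤ smallBound g K t ^ gam g :=
      Real.rpow_nonneg (by unfold smallBound; positivity) _
    have h2t : (0 : ℝ) < 2 ^ t := by positivity
    have f1 : growth g σ * growth g b ≤ 4115904 ^ 2 * (g * N) := by
      have := mul_le_mul hScard hYcard (by positivity) (by positivity)
      calc growth g σ * growth g b
          = 4115904 ^ 2 * (growth g σ / 4115904 * (growth g b / 4115904)) := by ring
        _ ≤ 4115904 ^ 2 * (g * N) := mul_le_mul_of_nonneg_left (this.trans hcardR) (by positivity)
    have f2 : K * t * 2 ^ t ≤ 128 * 4115904 ^ 2 * g * (growth g t * N) := by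
      calc K * t * 2 ^ t = smallBound g K t ^ gam g * growth g t * growth g t := by
            rw [← e1]; ring
        _ ≤ growth g σ * (128 * growth g b) * growth g t := by gcongr
        _ = 128 * growth g t * (growth g σ * growth g b) := by ring
        _ ≤ 128 * growth g t * (4115904 ^ 2 * (g * N)) := by gcongr
        _ = _ := by ring
    have f3 : 68 * 768 * 4115904 ^ 2 * g * t * 2 ^ t ≤
        128 * 4115904 ^ 2 * g * (growth g t * N) := le_trans (by gcongr) f2
    have f4 : 6 * (t : ℝ) * (68 * 2 ^ t) ≤ growth g t * N := by
      refine le_of_mul_le_mul_left ?_ (show (0 : ℝ) < 128 * 4115904 ^ 2 * g by positivity)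
      linarith
    rw [prob, div_mul_eq_mul_div, le_div_iff₀ (by positivity)]
    exact f4

end Stage

/-- The conditions on the thresholds under which the construction can be carried out. -/
structure Admissible (g t₀ t₁ : ℕ) (K : ℝ) : Prop where
  two_le : 2 ≤ g
  le_K : 68 * 768 * 4115904 ^ 2 * g ≤ K
  le_growth : ∀ t, t₀ ≤ t → 6 * 4115904 ≤ growth g t
  le_t₁ : t₀ + 7 ≤ t₁
  le_smallBound : ∀ t, t₁ ≤ t → 2 ^ t₀ ≤ smallBound g K t
  smallBound_le : ∀ t, t₁ ≤ t → 4096 * smallBound g K t ≤ 2 ^ t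

open Filter in
lemma exists_admissible {g : ℕ} (hg : 2 ≤ g) : ∃ t₀ t₁ K, Admissible g t₀ t₁ K := by
  set K : ℝ := 68 * 768 * 4115904 ^ 2 * g with hKdef
  have hK : 1 ≤ K := by
    have : (2 : ℝ) ≤ g := by exact_mod_cast hg
    rw [hKdef]
    linarith
  obtain ⟨t₀, h0⟩ := eventually_atTop.1 (eventually_le_growth hg (6 * 4115904))
  obtain ⟨t₁, h1⟩ := eventually_atTop.1 (eventually_smallBound_le hg hK)
  refine ⟨t₀, max t₁ (max (t₀ + 7) (2 ^ t₀)), K, hg, le_rfl, h0, by simp, fun t ht => ?_,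
    fun t ht => h1 t ((le_max_left _ _).trans ht)⟩
  have ht' : 2 ^ t₀ ≤ t := (le_max_right _ _).trans ((le_max_right _ _).trans ht)
  have : (2 : ℝ) ^ t₀ ≤ t := by exact_mod_cast ht'
  exact this.trans (le_smallBound hK ((Nat.one_le_two_pow).trans ht'))

lemma sum_miss_le {t : ℕ} (ht : 2 ≤ t) {p : ℝ} (hp1 : p ≤ 1)
    (I : Finset ℕ) (hI : I ⊆ Finset.range (2 ^ (t + 2))) (W : ℕ → Finset ℕ)
    (hW : ∀ n ∈ I, 6 * (t : ℝ) ≤ p * (W n).card) :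
    ∑ n ∈ I, (1 - p / 2) ^ (W n).card ≤ 1 / 4 := by
  have hb : ∀ n ∈ I, (1 - p / 2) ^ (W n).card ≤ 1 / 8 ^ t := by
    intro n hn
    refine (one_sub_pow_le_exp (by linarith) _).trans (le_trans ?_ (exp_neg_three_mul_le t))
    rw [Real.exp_le_exp]
    linarith [hW n hn]
  have hIc : (I.card : ℝ) ≤ 2 ^ (t + 2) := by
    have := Finset.card_le_card hI
    rw [Finset.card_range] at this
    exact_mod_cast this
  obtain ⟨u, rfl⟩ := Nat.exists_eq_add_of_le' ht
  calc ∑ n ∈ I, (1 - p / 2) ^ (W n).card ≤ ∑ n ∈ I, 1 / 8 ^ (u + 2) := Finset.sum_le_sum hb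
    _ = I.card * (1 / 8 ^ (u + 2)) := by rw [Finset.sum_const, nsmul_eq_mul]
    _ ≤ 2 ^ (u + 2 + 2) * (1 / 8 ^ (u + 2)) := by gcongr
    _ = 1 / 4 * (2 / 8) ^ u := by rw [div_pow, pow_add, pow_add, pow_add]; field_simp; norm_num
    _ ≤ 1 / 4 * 1 := by gcongr; exact pow_le_one₀ (by norm_num) (by norm_num)
    _ = 1 / 4 := mul_one _

lemma sum_few_le {g t : ℕ} (hU : 6 * 4115904 ≤ growth g t) (ht : 32 * 3783 ≤ 2 ^ t) :
    ∑ r ∈ (residues t).toFinset, 2 ^ ⌊growth g t / 4115904⌋₊ *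
      (1 - prob g t / 4) ^ (levelClass t r).card ≤ 1 / 4 := by
  set y := growth g t / 4115904 with hy
  have hy6 : 6 ≤ y := by rw [hy, le_div_iff₀ (by norm_num)]; exact hU
  have hp := prob_pos g t
  have hb : ∀ r ∈ (residues t).toFinset, 2 ^ ⌊y⌋₊ *
      (1 - prob g t / 4) ^ (levelClass t r).card ≤ Real.exp (-y) := by
    intro r hr
    have h1 := le_card_levelClass (List.mem_toFinset.1 hr) ht
    have h2 : 2 * y ≤ prob g t / 4 * (levelClass t r).card := by
      have := mul_le_mul_of_nonneg_left h1 hp.le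
      have e := prob_mul_two_pow g t
      rw [← mul_div_assoc, e] at this
      rw [hy]
      linarith
    have h3 := one_sub_pow_le_exp (x := prob g t / 4) (by linarith [prob_lt_one g t])
      (levelClass t r).card
    have h4 : (2 : ℝ) ^ ⌊y⌋₊ ≤ Real.exp y := by
      have h2 : (2 : ℝ) ≤ Real.exp 1 := by
        have := Real.add_one_le_exp (1 : ℝ)
        linarith
      calc (2 : ℝ) ^ ⌊y⌋₊ ≤ Real.exp 1 ^ ⌊y⌋₊ := by gcongr
        _ = Real.exp ⌊y⌋₊ := by rw [← Real.exp_nat_mul, mul_one]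
        _ ≤ Real.exp y := Real.exp_le_exp.2 (Nat.floor_le (by linarith))
    calc 2 ^ ⌊y⌋₊ * (1 - prob g t / 4) ^ (levelClass t r).card
        ≤ Real.exp y * Real.exp (-(2 * y)) := by
          refine mul_le_mul h4 (h3.trans ?_) ?_ (Real.exp_pos _).le
          · rw [Real.exp_le_exp]; linarith
          · exact pow_nonneg (by linarith [prob_lt_one g t]) _
      _ = Real.exp (-y) := by rw [← Real.exp_add]; congr 1; ring
  refine (Finset.sum_le_sum hb).trans (le_trans ?_ (twenty_three_mul_exp_le hy6))
  rw [Finset.sum_const, nsmul_eq_mul]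
  refine mul_le_mul_of_nonneg_right ?_ (Real.exp_pos _).le
  exact_mod_cast (List.toFinset_card_le _).trans (length_residues_le t)

lemma Stage.exists_succ {g t₀ t₁ t : ℕ} {K : ℝ} {O : Finset ℕ} (ha : Admissible g t₀ t₁ K)
    (h : Stage g t₀ t₁ K t O) (ht : t₀ ≤ t) : ∃ O', O ⊆ O' ∧ Stage g t₀ t₁ K (t + 1) O' := by
  classical
  have hU := ha.le_growth t ht
  have hUpos := growth_pos g t
  have hp := prob_pos g t
  have h2t : 32 * 3783 ≤ 2 ^ t := by
    have h3 : ((32 * 3783 : ℕ) : ℝ) ≤ (2 ^ t : ℕ) := by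
      push_cast
      linarith [growth_le_two_pow g t]
    exact_mod_cast h3
  have hΩ : prob g t * (level t).card ≤ growth g t / 68 := by
    rw [← prob_mul_two_pow]
    refine mul_le_mul_of_nonneg_left ?_ hp.le
    exact_mod_cast card_level_le t
  let I : Finset ℕ := (Finset.range (2 ^ (t + 2))).filter fun n =>
    t₁ ≤ t ∧ 33 * 2 ^ t ≤ 32 * n ∧ 32 * n < 33 * 2 ^ (t + 1)
  have hex : ∀ n ∈ I, ∃ W ⊆ level t, (∀ w ∈ W, ∃ y ∈ O, ∃ s ∈ O, n = w + y + s ∧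
      (s : ℝ) ≤ 16 * smallBound g K t) ∧ 6 * (t : ℝ) ≤ prob g t * W.card := by
    intro n hn
    obtain ⟨-, h0, h1, h2⟩ := Finset.mem_filter.1 hn
    exact h.exists_completions ha.two_le ha.le_K (ha.le_t₁.trans h0) (ha.le_smallBound t h0)
      (ha.smallBound_le t h0) h1 h2
  choose! W hWsub hWrep hWcard using hex
  have ht2 : 2 ≤ t := by
    by_contra hlt
    have : 2 ^ t ≤ 2 ^ 1 := Nat.pow_le_pow_right (by norm_num) (by omega)
    omega
  obtain ⟨X, hX, hXB, hXI, hXJ, hXcard⟩ := exists_extension hp.le (prob_lt_one g t) h.disjoint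
    h.sep (prob_pow_mul_le g t (by positivity) (by linarith [h.card_le])) h.isB2g I W hWsub
    (sum_miss_le ht2 (prob_lt_one g t).le I (Finset.filter_subset _ _) W hWcard)
    (residues t).toFinset (levelClass t) (fun r _ => Finset.filter_subset _ _) _
    (sum_few_le hU h2t) (B := 4 * (growth g t / 68)) (by positivity) (by linarith)
  refine ⟨O ∪ X, Finset.subset_union_left, ?_, hXB, ?_, ?_, ?_⟩
  · intro x hx
    rcases Finset.mem_union.1 hx with hx | hx
    · obtain ⟨s, h1, h2, h3⟩ := h.sub x hx
      exact ⟨s, h1, by omega, h3⟩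
    · exact ⟨t, ht, by omega, hX hx⟩
  · have h1 : ((O ∪ X).card : ℝ) ≤ O.card + X.card := by exact_mod_cast Finset.card_union_le O X
    have h2 := growth_succ_ge ha.two_le t
    linarith [h.card_le]
  · intro s hs1 hs2 r hr
    rcases Nat.lt_succ_iff_lt_or_eq.1 hs2 with hs | rfl
    · refine (h.le_card s hs1 hs r hr).trans ?_
      exact_mod_cast Finset.card_le_card
        (Finset.inter_subset_inter_right Finset.subset_union_left)
    · have h1 := hXJ r (List.mem_toFinset.2 hr)
      refine (Nat.lt_of_floor_lt h1).le.trans ?_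
      exact_mod_cast Finset.card_le_card
        (Finset.inter_subset_inter_right Finset.subset_union_right)
  · intro s hs1 hs2 n hn1 hn2
    rcases Nat.lt_succ_iff_lt_or_eq.1 hs2 with hs | rfl
    · obtain ⟨a₁, h1, a₂, h2, a₃, h3, h4⟩ := h.cover s hs1 hs n hn1 hn2
      exact ⟨a₁, Finset.mem_union_left _ h1, a₂, Finset.mem_union_left _ h2, a₃,
        Finset.mem_union_left _ h3, h4⟩
    · have hnI : n ∈ I := by
        refine Finset.mem_filter.2 ⟨Finset.mem_range.2 ?_, hs1, hn1, hn2⟩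
        rw [pow_succ] at hn2 ⊢
        rw [pow_succ]
        omega
      obtain ⟨x, hx, hxW⟩ := hXI n hnI
      obtain ⟨y, hy, z, hz, h4⟩ := hWrep n hnI x hxW
      exact ⟨x, Finset.mem_union_right _ hx, y, Finset.mem_union_left _ hy, z,
        Finset.mem_union_left _ hz, h4⟩

/-! ### The infinite sequence -/

lemma exists_stages {g t₀ t₁ : ℕ} {K : ℝ} (ha : Admissible g t₀ t₁ K) :
    ∃ F : ℕ → Finset ℕ, Monotone F ∧ ∀ k, Stage g t₀ t₁ K (t₀ + k) (F k) := by
  have h0 : Stage g t₀ t₁ K t₀ ∅ := stage_empty (le_trans (by omega) ha.le_t₁)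
  have hs : ∀ (k : ℕ) (O : Finset ℕ), ∃ O', Stage g t₀ t₁ K (t₀ + k) O →
      O ⊆ O' ∧ Stage g t₀ t₁ K (t₀ + k + 1) O' := by
    intro k O
    by_cases h : Stage g t₀ t₁ K (t₀ + k) O
    · obtain ⟨O', h'⟩ := h.exists_succ ha (by omega)
      exact ⟨O', fun _ => h'⟩
    · exact ⟨O, fun h' => absurd h' h⟩
  choose next hnext using hs
  let F : ℕ → Finset ℕ := fun k => Nat.rec ∅ next k
  have hF : ∀ k, Stage g t₀ t₁ K (t₀ + k) (F k) := by
    intro k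
    induction k with
    | zero => exact h0
    | succ k ih => exact (hnext k (F k) ih).2
  exact ⟨F, monotone_nat_of_le_succ fun k => (hnext k (F k) (hF k)).1, hF⟩

lemma isB2g_iUnion {g : ℕ} {F : ℕ → Finset ℕ} (hF : Monotone F)
    (h : ∀ k, IsB2g (F k : Set ℕ) g) : IsB2g (⋃ k, (F k : Set ℕ)) g := by
  intro m
  have hfin : ∃ k, ∀ a ≤ m, a ∈ (⋃ k, (F k : Set ℕ)) → a ∈ F k := by
    have hex : ∀ a, ∃ k, a ∈ (⋃ k, (F k : Set ℕ)) → a ∈ F k := by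
      intro a
      by_cases ha : a ∈ (⋃ k, (F k : Set ℕ))
      · obtain ⟨k, hk⟩ := Set.mem_iUnion.1 ha
        exact ⟨k, fun _ => hk⟩
      · exact ⟨0, fun h => absurd h ha⟩
    choose κ hκ using hex
    refine ⟨(Finset.range (m + 1)).sup κ, fun a ham ha => ?_⟩
    exact hF (Finset.le_sup (Finset.mem_range.2 (Nat.lt_succ_of_le ham))) (hκ a ha)
  obtain ⟨k, hk⟩ := hfin
  refine le_trans ?_ (h k m)
  refine Set.ncard_le_ncard (fun r hr => ?_) ?_
  · obtain ⟨h1, h2, h3, h4⟩ := hr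
    exact ⟨hk _ (by omega) h1, hk _ (by omega) h2, h3, h4⟩
  · refine (reps (F k) m).finite_toSet.subset fun r hr => ?_
    exact mem_reps.2 hr

lemma smallBound_le_log {g : ℕ} {K : ℝ} (hK : 0 ≤ K) {t n : ℕ} (htn : 2 ^ t ≤ n) :
    smallBound g K t ≤ (2 * K) ^ (2 + (1 : ℝ) / (g : ℝ)) * (n : ℝ) ^ ((1 : ℝ) / (g : ℝ)) *
      Real.log n ^ (2 + (1 : ℝ) / (g : ℝ)) := by
  have htn' : (2 : ℝ) ^ t ≤ n := by exact_mod_cast htn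
  have h2t : (0 : ℝ) < 2 ^ t := by positivity
  have hlog : t * Real.log 2 ≤ Real.log n := by
    rw [← Real.log_pow]
    exact Real.log_le_log h2t htn'
  have hlog2 := Real.log_two_gt_d9
  have ht0 : (0 : ℝ) ≤ t := by positivity
  have ht : (t : ℝ) ≤ 2 * Real.log n := by nlinarith
  have hlog0 : 0 ≤ Real.log n := by linarith
  calc smallBound g K t
      ≤ (2 * K * Real.log n) ^ (2 + (1 : ℝ) / (g : ℝ)) * (n : ℝ) ^ ((1 : ℝ) / (g : ℝ)) := by
        unfold smallBound
        refine mul_le_mul (Real.rpow_le_rpow (by positivity) ?_ (by positivity))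
          (Real.rpow_le_rpow h2t.le htn' (by positivity)) (by positivity) (by positivity)
        nlinarith [mul_le_mul_of_nonneg_left ht hK]
    _ = _ := by
        rw [Real.mul_rpow (by positivity) hlog0]
        ring

theorem stmt0 (g : ℕ) (hg : 2 ≤ g) :
    ∃ (A : Set ℕ) (C c : ℝ) (N₀ : ℕ), 0 < C ∧ 0 < c ∧ IsB2g A g ∧
      (∀ n : ℕ, N₀ ≤ n → ∃ a₁ ∈ A, ∃ a₂ ∈ A, ∃ a₃ ∈ A,
        n = a₁ + a₂ + a₃ ∧
        (a₃ : ℝ) ≤ C * (n : ℝ) ^ ((1 : ℝ) / (g : ℝ)) * Real.log n ^ (2 + (1 : ℝ) / (g : ℝ))) ∧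
      (∀ x : ℝ, (N₀ : ℝ) ≤ x →
        c * x ^ ((g : ℝ) / (2 * (g : ℝ) + 1)) ≤ (countTo A x : ℝ)) := by
  obtain ⟨t₀, t₁, K, ha⟩ := exists_admissible hg
  obtain ⟨F, hmono, hF⟩ := exists_stages ha
  have hK : 0 < K := lt_of_lt_of_le (by positivity) ha.le_K
  have hFA : ∀ k, ∀ a ∈ F k, a ∈ ⋃ k, (F k : Set ℕ) := fun k a h => Set.mem_iUnion.2 ⟨k, h⟩
  have ht₁ := ha.le_t₁
  refine ⟨⋃ k, (F k : Set ℕ), 16 * (2 * K) ^ (2 + (1 : ℝ) / (g : ℝ)), 1 / (4 * 4115904),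
    2 ^ (t₁ + 2), by positivity, by norm_num, isB2g_iUnion hmono fun k => (hF k).isB2g, ?_, ?_⟩
  · intro n hn
    have hpos : 0 < 32 * n / 33 := by
      have : 2 ^ 2 ≤ 2 ^ (t₁ + 2) := Nat.pow_le_pow_right (by norm_num) (by omega)
      omega
    set t := Nat.log 2 (32 * n / 33) with ht
    have h1 : 2 ^ t ≤ 32 * n / 33 := Nat.pow_log_le_self 2 hpos.ne'
    have h2 : 32 * n / 33 < 2 ^ (t + 1) := Nat.lt_pow_succ_log_self (by norm_num) _
    have hle : t₁ ≤ t := by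
      refine Nat.le_log_of_pow_le (by norm_num) ?_
      rw [pow_add] at hn
      omega
    have ht1 : t < t₀ + (t - t₀ + 1) := by omega
    obtain ⟨a₁, m1, a₂, m2, a₃, m3, e, hb⟩ := (hF (t - t₀ + 1)).cover t hle ht1 n (by omega)
      (by omega)
    refine ⟨a₁, hFA _ _ m1, a₂, hFA _ _ m2, a₃, hFA _ _ m3, e, hb.trans ?_⟩
    have := smallBound_le_log (g := g) hK.le (show 2 ^ t ≤ n by omega)
    linarith
  · intro x hx
    push_cast at hx
    have h4 : (2 : ℝ) ^ 2 ≤ 2 ^ (t₁ + 2) := pow_le_pow_right₀ one_le_two (by omega)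
    obtain ⟨m, hm1, hm2⟩ := exists_nat_pow_near (show 1 ≤ x by linarith) one_lt_two
    have hm : t₁ + 2 < m + 1 := (pow_lt_pow_iff_right₀ (one_lt_two (α := ℝ))).1 (hx.trans_lt hm2)
    obtain ⟨t, rfl⟩ := Nat.exists_eq_add_of_le' (show 1 ≤ m by omega)
    obtain ⟨r, hr⟩ := List.exists_mem_of_ne_nil _ (residues_ne_nil t)
    have hcard := (hF (t - t₀ + 1)).le_card t (by omega) (by omega) r hr
    have hx0 : 0 ≤ x := by linarith
    have hgrow : x ^ ((g : ℝ) / (2 * (g : ℝ) + 1)) ≤ 4 * growth g t := by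
      calc x ^ ((g : ℝ) / (2 * (g : ℝ) + 1)) ≤ growth g (t + 2) :=
            Real.rpow_le_rpow hx0 hm2.le (gam_nonneg g)
        _ ≤ 2 ^ 2 * growth g t := growth_add_le g t 2
        _ = 4 * growth g t := by norm_num
    have hcount : (F (t - t₀ + 1) ∩ levelClass t r).card ≤ countTo (⋃ k, (F k : Set ℕ)) x := by
      rw [← Set.ncard_coe_finset]
      refine Set.ncard_le_ncard (fun a ha => ?_) ?_
      · obtain ⟨k1, k2⟩ := Finset.mem_inter.1 ha
        obtain ⟨k3, k4, -⟩ := mem_level.1 (mem_levelClass.1 k2).1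
        have k5 : a ≤ 2 ^ (t + 1) := by rw [pow_succ]; omega
        have k6 : (a : ℝ) ≤ 2 ^ (t + 1) := by exact_mod_cast k5
        exact ⟨hFA _ _ k1, Nat.one_le_two_pow.trans k3, k6.trans hm1⟩
      · exact (Set.finite_Iic ⌊x⌋₊).subset fun a ha => Nat.le_floor ha.2.2
    have : ((F (t - t₀ + 1) ∩ levelClass t r).card : ℝ) ≤ countTo (⋃ k, (F k : Set ℕ)) x := by
      exact_mod_cast hcount
    linarith
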